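/- arXiv:2303.04453 — 3 statements merged into one kernel-verified Lean document; each statement's English description precedes it below -/
import Mathlib

section
/- For every integer t ≥ 2, the class of F_{t,t}-free finite bipartite graphs admits an implicit representation. -/
open SimpleGraph

/-- `F_{t,p}`: two stars `K_{1,t}` and `K_{1,p}` with their centers (`inl 0` and `inl 1`)
in one part of the bipartition, plus an isolated vertex (`inr (t+p)`) in the other part. -/
def Ftp (t p : ℕ) : SimpleGraph (Fin 2 ⊕ Fin (t + p + 1)) :=
  SimpleGraph.fromRel fun u v =>
    match u, v with
    | Sum.inl a, Sum.inr b => (a = 0 ∧ (b : ℕ) < t) ∨ (a = 1 ∧ t ≤ (b : ℕ) ∧ (b : ℕ) < t + p)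
    | _, _ => False

/-- A class of finite simple graphs, given by its members on the concrete
vertex sets `Fin n`. -/
abbrev GraphClass : Type := ∀ n : ℕ, SimpleGraph (Fin n) → Prop

/-- A class `C` admits an implicit representation. -/
def AdmitsImplicit (C : GraphClass) : Prop :=
  ∃ (c : ℕ) (D : ℕ → ℕ → Prop),
    ∀ n : ℕ, 2 ≤ n → ∀ G : SimpleGraph (Fin n), C n G →
      ∃ ℓ : Fin n → Fin (n ^ c), Function.Injective ℓ ∧
        ∀ u v : Fin n, u ≠ v → (G.Adj u v ↔ D (ℓ u).val (ℓ v).val)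

open Finset in
theorem peel_aux {V : Type*} [Fintype V] [DecidableEq V] (P : V → Finset V → Prop)
    (h : ∀ S : Finset V, S.Nonempty → ∃ v ∈ S, P v S) (k : ℕ) :
    ∀ S : Finset V, #S = k → ∃ rank : V → ℕ, (∀ v ∈ S, rank v < k) ∧
      ∀ v ∈ S, ∃ S' : Finset V, P v S' ∧ ∀ u ∈ S, rank v ≤ rank u → u ∈ S' := by
  induction k with
  | zero =>
    intro S hS
    rw [card_eq_zero] at hS
    subst hS
    exact ⟨fun _ => 0, by simp, by simp⟩
  | succ k ih =>
    intro S hS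
    obtain ⟨v, hv, hP⟩ := h S (card_pos.mp (by omega))
    obtain ⟨r, hr, hr2⟩ := ih (S.erase v) (by rw [card_erase_of_mem hv]; omega)
    refine ⟨fun u => if u = v then 0 else r u + 1, ?_, ?_⟩
    · intro u hu
      by_cases huv : u = v
      · simp [huv]
      · have := hr u (mem_erase.mpr ⟨huv, hu⟩)
        simp [huv, this]
    · intro u hu
      by_cases huv : u = v
      · subst huv
        exact ⟨S, hP, fun w hw _ => hw⟩
      · obtain ⟨S', hS', h2⟩ := hr2 u (mem_erase.mpr ⟨huv, hu⟩)
        refine ⟨S', hS', fun w hw hle => ?_⟩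
        by_cases hwv : w = v
        · simp [huv, hwv] at hle
        · simp [huv, hwv] at hle
          exact h2 w (mem_erase.mpr ⟨hwv, hw⟩) hle

/-- `u` and `v` have a common neighbour -/
def Meet {V : Type*} (A : V → V → Prop) (u v : V) : Prop := ∃ w, A u w ∧ A v w

theorem Meet.symm {V : Type*} {A : V → V → Prop} {u v : V} (h : Meet A u v) : Meet A v u := by
  obtain ⟨w, h1, h2⟩ := h
  exact ⟨w, h2, h1⟩

open Classical Finset in
/-- the number of neighbours is at least `2 * t` -/
def Big {V : Type*} [Fintype V] (A : V → V → Prop) (t : ℕ) (u : V) : Prop :=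
  2 * t ≤ #{w | A u w}

open Classical Finset in
/-- the big neighbours of `b` that precede `a` -/
noncomputable def lowNbr {V : Type*} [Fintype V] (A : V → V → Prop) (t : ℕ) (pos : V → ℕ) (b a : V) :
    Finset V := {c | A b c ∧ Big A t c ∧ pos c < pos a}

open Finset in
/-- high edges -/
def High {V : Type*} [Fintype V] (A : V → V → Prop) (t : ℕ) (pos : V → ℕ) (a b : V) : Prop :=
  A a b ∧ Big A t a ∧ Big A t b ∧ t ≤ #(lowNbr A t pos b a) ∧ t ≤ #(lowNbr A t pos a b)

open Classical Finset in
/-- almost nested condition -/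
def Nest {V : Type*} [Fintype V] (A : V → V → Prop) (t : ℕ) (pos : V → ℕ) : Prop :=
  ∀ u v, pos u ≤ pos v → Meet A u v → #{w | A u w ∧ ¬ A v w} < t

section
variable {V : Type*} [Fintype V] {A : V → V → Prop} {t : ℕ} {pos : V → ℕ}

open Classical Finset in
theorem nest_F1 (hN : Nest A t pos) {a b c : V} (ha : Big A t a) (hab : pos a ≤ pos b)
    (hac : pos a ≤ pos c) (mab : Meet A a b) (mac : Meet A a c) : Meet A b c := by
  by_contra hcon
  have h1 := hN a b hab mab
  have h2 := hN a c hac mac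
  unfold Big at ha
  have : ({w | A a w} : Finset V) ⊆ ({w | A a w ∧ ¬ A b w} : Finset V) ∪ ({w | A a w ∧ ¬ A c w} : Finset V) := by
    intro w hw
    simp only [mem_filter, mem_univ, true_and, mem_union] at *
    by_contra hh
    exact hcon ⟨w, by tauto, by tauto⟩
  have := (card_le_card this).trans (card_union_le _ _)
  omega

open Classical Finset in
theorem nest_F2 (hN : Nest A t pos) {a b c : V} (ha : Big A t a) (hab : pos a ≤ pos b)
    (hbc : pos b ≤ pos c) (mab : Meet A a b) (mbc : Meet A b c) : Meet A a c := by
  by_contra hcon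
  have h1 := hN a b hab mab
  have h2 := hN b c hbc mbc
  unfold Big at ha
  have : ({w | A a w} : Finset V) ⊆ ({w | A a w ∧ ¬ A b w} : Finset V) ∪ ({w | A b w ∧ ¬ A c w} : Finset V) := by
    intro w hw
    simp only [mem_filter, mem_univ, true_and, mem_union] at *
    by_contra hh
    exact hcon ⟨w, by tauto, by tauto⟩
  have := (card_le_card this).trans (card_union_le _ _)
  omega

theorem High.symm (hs : ∀ u v, A u v → A v u) {a b : V} (h : High A t pos a b) : High A t pos b a :=
  ⟨hs _ _ h.1, h.2.2.1, h.2.1, h.2.2.2.2, h.2.2.2.1⟩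

open Classical Finset in
/-- if `(a,b)` is high and `b` precedes and meets `b2`, there is a big `c` below `a` adjacent to both -/
theorem high_low (hN : Nest A t pos) {a b b2 : V} (h : High A t pos a b) (hb : pos b ≤ pos b2)
    (m : Meet A b b2) : ∃ c, A b c ∧ A b2 c ∧ Big A t c ∧ pos c ≤ pos a := by
  by_contra hcon
  push Not at hcon
  have h1 := hN b b2 hb m
  have h2 := h.2.2.2.1
  have : lowNbr A t pos b a ⊆ ({w | A b w ∧ ¬ A b2 w} : Finset V) := by
    intro w hw
    simp only [lowNbr, mem_filter, mem_univ, true_and] at *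
    refine ⟨hw.1, fun hh => ?_⟩
    have := hcon w hw.1 hh hw.2.1
    omega
  have := card_le_card this
  omega

theorem high_meet (hs : ∀ u v, A u v → A v u) (hN : Nest A t pos) {a b a2 b2 : V}
    (h : High A t pos a b) (h2 : High A t pos a2 b2) (m : Meet A b b2) : Meet A a a2 := by
  wlog hle : pos b ≤ pos b2 generalizing a b a2 b2
  · exact (this h2 h m.symm (by omega)).symm
  obtain ⟨c, hc1, hc2, hc3, hc4⟩ := high_low hN h hle m
  have m1 : Meet A c a := ⟨b, hs _ _ hc1, h.1⟩
  have m2 : Meet A c a2 := ⟨b2, hs _ _ hc2, h2.1⟩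
  rcases le_total (pos c) (pos a2) with h3 | h3
  · exact nest_F1 hN hc3 hc4 h3 m1 m2
  · exact (nest_F2 hN h2.2.1 h3 hc4 m2.symm m1).symm

theorem high_trans (hs : ∀ u v, A u v → A v u) (hN : Nest A t pos) {a b a1 b1 a2 b2 : V}
    (h0 : High A t pos a b) (h1 : High A t pos a1 b1) (h2 : High A t pos a2 b2)
    (m0 : Meet A a a1) (m1 : Meet A a1 a2) : Meet A a a2 := by
  have n0 : Meet A b b1 := high_meet hs hN (h0.symm hs) (h1.symm hs) m0
  have n1 : Meet A b1 b2 := high_meet hs hN (h1.symm hs) (h2.symm hs) m1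
  by_cases c0 : pos b ≤ pos b1
  · by_cases c1 : pos b2 ≤ pos b1
    · obtain ⟨c, hc1, hc2, hc3, hc4⟩ := high_low hN h0 c0 n0
      obtain ⟨d, hd1, hd2, hd3, hd4⟩ := high_low hN h2 c1 n1.symm
      have mcd : Meet A c d := ⟨b1, hs _ _ hc2, hs _ _ hd2⟩
      have mc : Meet A c a := ⟨b, hs _ _ hc1, h0.1⟩
      have md : Meet A d a2 := ⟨b2, hs _ _ hd1, h2.1⟩
      rcases le_total (pos c) (pos d) with h3 | h3
      · exact nest_F1 hN hc3 hc4 (h3.trans hd4) mc (nest_F2 hN hc3 h3 hd4 mcd md)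
      · exact nest_F1 hN hd3 (h3.trans hc4) hd4 (nest_F2 hN hd3 h3 hc4 mcd.symm mc) md
    · exact high_meet hs hN h0 h2 (nest_F2 hN h0.2.2.1 c0 (by omega) n0 n1)
  · by_cases c1 : pos b2 ≤ pos b1
    · exact high_meet hs hN h0 h2 (nest_F2 hN h2.2.2.1 c1 (by omega) n1.symm n0.symm).symm
    · exact high_meet hs hN h0 h2 (nest_F1 hN h1.2.2.1 (by omega) (by omega) n0.symm n1)

/-- classes and partner classes -/
theorem exists_classes (hs : ∀ u v, A u v → A v u) (hN : Nest A t pos) :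
    ∃ q nq : V → V, (∀ u v, High A t pos u v → nq u = q v) ∧
      (∀ u v, u ≠ v → nq u = q v → nq v = q u) ∧
      (∀ u v w, v ≠ u → w ≠ u → nq u = q v → nq u = q w → Meet A v w) := by
  classical
  let W : V → Prop := fun u => ∃ v, High A t pos u v
  let r : V → V → Prop := fun u v => u = v ∨ (W u ∧ W v ∧ Meet A u v)
  have hr : Equivalence r := by
    refine ⟨fun u => Or.inl rfl, ?_, ?_⟩
    · rintro u v (h | ⟨h1, h2, h3⟩)
      · exact Or.inl h.symm
      · exact Or.inr ⟨h2, h1, h3.symm⟩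
    · rintro u v w (h | ⟨h1, h2, h3⟩) (h' | ⟨h1', h2', h3'⟩)
      · exact Or.inl (h.trans h')
      · subst h; exact Or.inr ⟨h1', h2', h3'⟩
      · subst h'; exact Or.inr ⟨h1, h2, h3⟩
      · obtain ⟨x, hx⟩ := h1
        obtain ⟨y, hy⟩ := h2
        obtain ⟨z, hz⟩ := h2'
        exact Or.inr ⟨⟨x, hx⟩, ⟨z, hz⟩, high_trans hs hN hx hy hz h3 h3'⟩
  let st : Setoid V := ⟨r, hr⟩
  let q : V → V := fun v => (Quotient.mk st v).out
  have hq : ∀ u v, q u = q v ↔ r u v := by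
    intro u v
    constructor
    · intro h
      have := congrArg (Quotient.mk st) h
      simp only [q, Quotient.out_eq] at this
      exact Quotient.exact this
    · intro h
      have : Quotient.mk st u = Quotient.mk st v := Quotient.sound h
      simp only [q, this]
  let p : V → V := fun v => if h : W v then h.choose else v
  have hp : ∀ v, W v → High A t pos v (p v) := by
    intro v h
    simp only [p, dif_pos h]
    exact h.choose_spec
  have hp' : ∀ v, ¬ W v → p v = v := by
    intro v h
    simp only [p, dif_neg h]
  have hWp : ∀ v, W v → W (p v) := fun v h => ⟨v, (hp v h).symm hs⟩
  have selfMeet : ∀ v, W v → Meet A v v := by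
    rintro v ⟨w, hw⟩
    exact ⟨w, hw.1, hw.1⟩
  -- meaning of the partner relation
  have key : ∀ u v, u ≠ v → q (p u) = q v → W u ∧ W v ∧ Meet A (p u) v := by
    intro u v huv h
    rw [hq] at h
    by_cases hu : W u
    · rcases h with h | ⟨h1, h2, h3⟩
      · have := hWp u hu
        rw [← h]
        exact ⟨hu, this, selfMeet _ this⟩
      · exact ⟨hu, h2, h3⟩
    · rw [hp' u hu] at h
      rcases h with h | ⟨h1, _⟩
      · exact absurd h huv
      · exact absurd h1 hu
  refine ⟨q, fun v => q (p v), ?_, ?_, ?_⟩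
  · intro u v h
    have hu : W u := ⟨v, h⟩
    have hv : W v := ⟨u, h.symm hs⟩
    rw [hq]
    refine Or.inr ⟨hWp u hu, hv, ?_⟩
    exact high_meet hs hN ((hp u hu).symm hs) (h.symm hs) (selfMeet u hu)
  · intro u v huv h
    obtain ⟨h1, h2, h3⟩ := key u v huv h
    rw [hq]
    refine Or.inr ⟨hWp v h2, h1, ?_⟩
    exact (high_meet hs hN (hp u h1) ((hp v h2).symm hs) h3).symm
  · intro u v w hv hw h1 h2
    obtain ⟨a1, a2, a3⟩ := key u v hv.symm h1
    have : q v = q w := h1.symm.trans h2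
    rw [hq] at this
    rcases this with h | h
    · rw [← h]; exact selfMeet v a2
    · exact h.2.2

open Classical Finset in
theorem exists_good (hs : ∀ u v, A u v → A v u) (hinj : Function.Injective pos) (hN : Nest A t pos) (q nq : V → V)
    (h2 : ∀ u v, u ≠ v → nq u = q v → nq v = q u)
    (h3 : ∀ u v w, v ≠ u → w ≠ u → nq u = q v → nq u = q w → Meet A v w)
    (S : Finset V) (hS : S.Nonempty) :
    ∃ v ∈ S, ∃ (s : ℕ) (E : Finset V), #E ≤ 2 * t ∧ (∃ u, s ≤ pos u + 1) ∧
      ∀ u ∈ S, u ≠ v → nq v = q u → (A v u ↔ (s ≤ pos u ↔ u ∉ E)) := by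
  obtain ⟨j, hj, hmin⟩ := S.exists_min_image pos hS
  let O : V → Finset V := fun i => {i' ∈ S | i' ≠ j ∧ nq j = q i' ∧ pos i' < pos i ∧ A j i'}
  by_cases hcase : ∃ i ∈ S, i ≠ j ∧ nq j = q i ∧ ¬ A j i ∧ 2 * t ≤ #(O i)
  · obtain ⟨i, hi, hij, hM, hnA, hU⟩ := hcase
    let Z : Finset V := {j' ∈ S | j' ≠ i ∧ nq i = q j' ∧ ¬ A i j'}
    refine ⟨i, hi, 0, Z, ?_, ⟨i, by omega⟩, ?_⟩
    · have hMi : nq i = q j := h2 j i hij.symm hM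
      -- double counting
      have lower : ∀ j' ∈ Z, #(O i) - (t - 1) ≤ #{i' ∈ O i | A i' j'} := by
        intro j' hj'
        simp only [Z, mem_filter] at hj'
        have m : Meet A j j' := h3 i j j' hij.symm hj'.2.1 hMi hj'.2.2.1
        have hlt := hN j j' (hmin j' hj'.1) m
        have hsub : ({i' ∈ O i | ¬ A i' j'} : Finset V) ⊆ ({w | A j w ∧ ¬ A j' w} : Finset V) := by
          intro x hx
          simp only [O, mem_filter, mem_univ, true_and] at *
          exact ⟨hx.1.2.2.2.2, fun hh => hx.2 (hs _ _ hh)⟩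
        have h5 := card_le_card hsub
        have h6 := card_filter_add_card_filter_not (s := O i) (fun i' => A i' j')
        omega
      have upper : ∀ i' ∈ O i, #{j' ∈ Z | A i' j'} ≤ t - 1 := by
        intro i' hi'
        simp only [O, mem_filter] at hi'
        have m : Meet A i' i := h3 j i' i hi'.2.1 hij hi'.2.2.1 hM
        have hlt := hN i' i hi'.2.2.2.1.le m
        have hsub : ({j' ∈ Z | A i' j'} : Finset V) ⊆ ({w | A i' w ∧ ¬ A i w} : Finset V) := by
          intro x hx
          simp only [Z, mem_filter, mem_univ, true_and] at *
          exact ⟨hx.2, hx.1.2.2.2⟩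
        have h5 := card_le_card hsub
        omega
      have hcount : #Z * (#(O i) - (t - 1)) ≤ #(O i) * (t - 1) := by
        calc #Z * (#(O i) - (t - 1)) ≤ ∑ j' ∈ Z, #{i' ∈ O i | A i' j'} := by
              rw [← smul_eq_mul]; exact card_nsmul_le_sum _ _ _ lower
          _ = ∑ i' ∈ O i, #{j' ∈ Z | A i' j'} := by
              exact (sum_card_bipartiteAbove_eq_sum_card_bipartiteBelow (s := O i) (t := Z) A).symm
          _ ≤ #(O i) * (t - 1) := by
              rw [← smul_eq_mul]; exact sum_le_card_nsmul _ _ _ upper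
      by_contra hcon
      push Not at hcon
      obtain ⟨d, hd⟩ : ∃ d, #(O i) = 2 * t + d := ⟨_, (Nat.add_sub_of_le hU).symm⟩
      rw [hd] at hcount
      rcases Nat.eq_zero_or_pos t with ht | ht
      · subst ht
        obtain ⟨x, hx⟩ := card_pos.mp (by omega : 0 < #Z)
        simp only [Z, mem_filter] at hx
        have m : Meet A i x := by
          have mm : Meet A j x := h3 i j x hij.symm hx.2.1 hMi hx.2.2.1
          have := hN j x (hmin x hx.1) mm
          omega
        have := hN i i le_rfl (by obtain ⟨w, hw, _⟩ := m; exact ⟨w, hw, hw⟩)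
        omega
      · have e1 : 2 * t + d - (t - 1) = t + 1 + d := by omega
        rw [e1] at hcount
        obtain ⟨k, rfl⟩ : ∃ k, t = k + 1 := ⟨t - 1, by omega⟩
        simp only [Nat.add_sub_cancel] at hcount
        nlinarith
    · intro u hu hui hM'
      simp only [Z, mem_filter, zero_le, true_iff]
      tauto
  · push Not at hcase
    let Zj : Finset V := {i ∈ S | i ≠ j ∧ nq j = q i ∧ ¬ A j i}
    by_cases hZ : Zj.Nonempty
    · obtain ⟨i, hi, hmax⟩ := Zj.exists_max_image pos hZ
      simp only [Zj, mem_filter] at hi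
      have hlt := hcase i hi.1 hi.2.1 hi.2.2.1 hi.2.2.2
      refine ⟨j, hj, pos i + 1, O i, hlt.le, ⟨i, le_rfl⟩, ?_⟩
      intro u hu huj hM
      constructor
      · intro hA
        simp only [O, mem_filter]
        constructor
        · intro h; omega
        · intro h
          by_contra hlt
          have : pos u ≠ pos i ∨ pos u = pos i := by tauto
          rcases this with h' | h'
          · exact h ⟨hu, huj, hM, by omega, hA⟩
          · rw [hinj h'] at hA
            exact hi.2.2.2 hA
      · intro h
        by_contra hA
        have : pos u ≤ pos i := hmax u (by simp only [Zj, mem_filter]; tauto)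
        have h7 : u ∉ O i := by simp only [O, mem_filter]; tauto
        have := h.mpr h7
        omega
    · refine ⟨j, hj, 0, ∅, by simp, ⟨j, by omega⟩, ?_⟩
      intro u hu huj hM
      simp only [zero_le, notMem_empty, not_false_eq_true, iff_true]
      by_contra hA
      exact hZ ⟨u, by simp only [Zj, mem_filter]; tauto⟩

end

open Classical Finset in
theorem core_rep {V : Type*} [Fintype V] {A : V → V → Prop} {t : ℕ} {pos : V → ℕ}
    (hs : ∀ u v, A u v → A v u) (hinj : Function.Injective pos)
    (hN : Nest A t pos) :
    ∃ (q nq : V → V) (L E : V → Finset V) (rank s : V → ℕ),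
      (∀ v, #(L v) ≤ 2 * t) ∧ (∀ v, #(E v) ≤ 2 * t) ∧ (∀ v, rank v < Fintype.card V) ∧
      (∀ v, ∃ u, s v ≤ pos u + 1) ∧
      ∀ u v, u ≠ v → (A u v ↔
        (nq u = q v ∧ rank u ≤ rank v ∧ (s u ≤ pos v ↔ v ∉ E u)) ∨
        (nq u = q v ∧ ¬ rank u ≤ rank v ∧ (s v ≤ pos u ↔ u ∉ E v)) ∨
        (nq u ≠ q v ∧ (v ∈ L u ∨ u ∈ L v))) := by
  obtain ⟨q, nq, h1, h2, h3⟩ := exists_classes hs hN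
  obtain ⟨rank, hr, hr2⟩ := peel_aux _ (exists_good hs hinj hN q nq h2 h3) _ univ rfl
  choose! S hS using hr2
  choose s E hE using fun v => (hS v (mem_univ v)).1
  let L : V → Finset V := fun v => if Big A t v then
    ({a | A v a ∧ Big A t a ∧ #(lowNbr A t pos v a) < t} : Finset V) else ({a | A v a} : Finset V)
  refine ⟨q, nq, L, E, rank, s, ?_, fun v => (hE v).1, fun v => hr v (mem_univ v),
    fun v => (hE v).2.1, ?_⟩
  · intro v
    by_cases hb : Big A t v
    · simp only [L, if_pos hb]
      have : #({a | A v a ∧ Big A t a ∧ #(lowNbr A t pos v a) < t} : Finset V) ≤ #(range t) := by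
        apply card_le_card_of_injOn (fun a => #(lowNbr A t pos v a))
        · intro a ha
          simp at ha ⊢
          exact ha.2.2
        · intro a ha b hb' hab
          simp at ha hb' hab
          have mono : ∀ x y, A v x → Big A t x → pos x < pos y →
              #(lowNbr A t pos v x) < #(lowNbr A t pos v y) := by
            intro x y hx hx' hxy
            apply card_lt_card
            rw [ssubset_iff_of_subset]
            · refine ⟨x, ?_, ?_⟩
              · simp [lowNbr, hx, hx', hxy]
              · simp [lowNbr]
            · intro z hz
              simp only [lowNbr, mem_filter, mem_univ, true_and] at *
              exact ⟨hz.1, hz.2.1, by omega⟩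
          rcases lt_trichotomy (pos a) (pos b) with h | h | h
          · have := mono a b ha.1 ha.2.1 h
            omega
          · exact hinj h
          · have := mono b a hb'.1 hb'.2.1 h
            omega
      rw [card_range] at this
      omega
    · simp only [L, if_neg hb]
      unfold Big at hb
      omega
  · intro u v huv
    by_cases hM : nq u = q v
    · have hM' := h2 u v huv hM
      by_cases hle : rank u ≤ rank v
      · have := (hE u).2.2 v ((hS u (mem_univ u)).2 v (mem_univ v) hle) huv.symm hM
        rw [this]
        tauto
      · have := (hE v).2.2 u ((hS v (mem_univ v)).2 u (mem_univ u) (by omega)) huv hM'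
        have h' : A u v ↔ A v u := ⟨hs _ _, hs _ _⟩
        rw [h', this]
        tauto
    · have hH : ¬ High A t pos u v := fun h => hM (h1 u v h)
      have hL : ∀ x y, y ∈ L x ↔ A x y ∧ (Big A t x → Big A t y ∧ #(lowNbr A t pos x y) < t) := by
        intro x y
        by_cases hb : Big A t x <;> simp [L, hb]
      have h' : A u v ↔ A v u := ⟨hs _ _, hs _ _⟩
      simp only [hL]
      simp only [High, ← not_lt] at hH
      tauto

/-- iterated pairing is an injective, polynomially bounded code for tuples -/
theorem exists_enc (k : ℕ) : ∃ (enc : (Fin k → ℕ) → ℕ) (d : ℕ), Function.Injective enc ∧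
    ∀ n, 2 ≤ n → ∀ f, (∀ i, f i < n ^ 3) → enc f < n ^ d := by
  induction k with
  | zero =>
    refine ⟨fun _ => 0, 0, fun f g _ => Subsingleton.elim _ _, fun n _ f _ => by simp⟩
  | succ k ih =>
    obtain ⟨enc, d, hinj, hb⟩ := ih
    refine ⟨fun f => Nat.pair (f 0) (enc (fun i => f i.succ)), (3 + d) * 2, ?_, ?_⟩
    · intro f g h
      simp only [Nat.pair_eq_pair] at h
      have := hinj h.2
      funext i
      refine Fin.cases h.1 (fun i => congrFun this i) i
    · intro n hn f hf
      have h1 := hb n hn (fun i => f i.succ) (fun i => hf _)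
      have h2 := hf 0
      have h3 := Nat.pair_lt_max_add_one_sq (f 0) (enc (fun i => f i.succ))
      refine h3.trans_le ?_
      rw [pow_mul]
      apply Nat.pow_le_pow_left
      have a1 : n ^ 3 ≤ n ^ (3 + d) := Nat.pow_le_pow_right (by omega) (by omega)
      have a2 : n ^ d ≤ n ^ (3 + d) := Nat.pow_le_pow_right (by omega) (by omega)
      have := max_lt (h2.trans_le a1) (h1.trans_le a2)
      omega

theorem admits_of_tuples (ι : Type) [Fintype ι] (Dec : (ι → ℕ) → (ι → ℕ) → Prop) (C : GraphClass)
    (i0 : ι) (h : ∀ n, 2 ≤ n → ∀ G : SimpleGraph (Fin n), C n G → ∃ f : Fin n → ι → ℕ,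
      (∀ v i, f v i < n ^ 3) ∧ (∀ v, f v i0 = v.val) ∧
      ∀ u v, u ≠ v → (G.Adj u v ↔ Dec (f u) (f v))) : AdmitsImplicit C := by
  obtain ⟨enc, d, hinj, hb⟩ := exists_enc (Fintype.card ι)
  let e := Fintype.equivFin ι
  let enc' : (ι → ℕ) → ℕ := fun f => enc (f ∘ e.symm)
  have hinj' : Function.Injective enc' := by
    intro f g hfg
    have := hinj hfg
    funext i
    simpa using congrFun this (e i)
  refine ⟨d, fun x y => ∃ f g, enc' f = x ∧ enc' g = y ∧ Dec f g, ?_⟩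
  intro n hn G hG
  obtain ⟨f, hf1, hf2, hf3⟩ := h n hn G hG
  refine ⟨fun v => ⟨enc' (f v), hb n hn _ (fun i => hf1 _ _)⟩, ?_, ?_⟩
  · intro u v huv
    simp only [Fin.mk.injEq] at huv
    have := hinj' huv
    apply Fin.ext
    rw [← hf2, ← hf2, this]
  · intro u v huv
    rw [hf3 u v huv]
    constructor
    · intro hd
      exact ⟨_, _, rfl, rfl, hd⟩
    · rintro ⟨f', g', h1, h2, h3⟩
      rw [← hinj' h1, ← hinj' h2]
      exact h3

open Finset in
/-- a small set of vertices as a tuple -/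
theorem exists_list {n K : ℕ} (E : Finset (Fin n)) (hE : #E ≤ K) :
    ∃ e : Fin K → ℕ, (∀ i, e i ≤ n) ∧ ∀ v : Fin n, v ∈ E ↔ ∃ i, e i = v.val := by
  refine ⟨fun i => if h : i.val < #E then (E.equivFin.symm ⟨i.val, h⟩ : E).val.val else n, ?_, ?_⟩
  · intro i
    dsimp only
    split_ifs
    · exact (Fin.is_lt _).le
    · exact le_rfl
  · intro v
    constructor
    · intro hv
      refine ⟨⟨(E.equivFin ⟨v, hv⟩).val, (Fin.is_lt _).trans_le hE⟩, ?_⟩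
      simp
    · rintro ⟨i, hi⟩
      dsimp only at hi
      split_ifs at hi with h
      · rw [← Fin.ext hi]
        exact Subtype.coe_prop _
      · have := v.isLt
        omega

open Classical Finset in
/-- `F_{t,t}`-freeness in terms of the bipartite complement -/
theorem nest_of_free {n t : ℕ} (ht : 2 ≤ t) (G : SimpleGraph (Fin n)) (c : G.Coloring (Fin 2))
    (hF : ¬ Nonempty (Ftp t t ↪g G)) (u v w : Fin n)
    (hu : c u ≠ c w ∧ ¬ G.Adj u w) (hv : c v ≠ c w ∧ ¬ G.Adj v w)
    (h1 : t ≤ #{x | (c u ≠ c x ∧ ¬ G.Adj u x) ∧ ¬ (c v ≠ c x ∧ ¬ G.Adj v x)})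
    (h2 : t ≤ #{x | (c v ≠ c x ∧ ¬ G.Adj v x) ∧ ¬ (c u ≠ c x ∧ ¬ G.Adj u x)}) : False := by
  have hc : c u = c v := by
    have a := hu.1
    have b := hv.1
    omega
  obtain ⟨P, hP1, hP2⟩ := exists_subset_card_eq h1
  obtain ⟨Q, hQ1, hQ2⟩ := exists_subset_card_eq h2
  have hP : ∀ x ∈ P, c u ≠ c x ∧ ¬ G.Adj u x ∧ G.Adj v x := by
    intro x hx
    have := hP1 hx
    simp only [mem_filter, mem_univ, true_and, ← hc] at this
    tauto
  have hQ : ∀ x ∈ Q, c u ≠ c x ∧ ¬ G.Adj v x ∧ G.Adj u x := by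
    intro x hx
    have := hQ1 hx
    simp only [mem_filter, mem_univ, true_and, ← hc] at this
    tauto
  let fP := (P.equivFinOfCardEq hP2).symm
  let fQ := (Q.equivFinOfCardEq hQ2).symm
  let leaf : Fin (t + t + 1) → Fin n := fun b =>
    if h : b.val < t then (fQ ⟨b.val, h⟩).val
    else if h' : b.val < t + t then (fP ⟨b.val - t, by omega⟩).val else w
  have leafQ : ∀ b (h : b.val < t), leaf b = (fQ ⟨b.val, h⟩).val := by
    intro b h
    simp only [leaf, dif_pos h]
  have leafP : ∀ b (h : ¬ b.val < t) (h' : b.val < t + t),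
      leaf b = (fP ⟨b.val - t, by omega⟩).val := by
    intro b h h'
    simp only [leaf, dif_neg h, dif_pos h']
  have leafW : ∀ b (h' : ¬ b.val < t + t), leaf b = w := by
    intro b h'
    have h : ¬ b.val < t := by omega
    simp only [leaf, dif_neg h, dif_neg h']
  have hleafQ : ∀ b, b.val < t → leaf b ∈ Q := by
    intro b h
    rw [leafQ b h]; exact Subtype.coe_prop _
  have hleafP : ∀ b, ¬ b.val < t → b.val < t + t → leaf b ∈ P := by
    intro b h h'
    rw [leafP b h h']; exact Subtype.coe_prop _
  have hcol : ∀ b, c u ≠ c (leaf b) := by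
    intro b
    by_cases h : b.val < t
    · exact (hQ _ (hleafQ b h)).1
    · by_cases h' : b.val < t + t
      · exact (hP _ (hleafP b h h')).1
      · rw [leafW b h']; exact hu.1
  have hadju : ∀ b, G.Adj u (leaf b) ↔ b.val < t := by
    intro b
    by_cases h : b.val < t
    · exact iff_of_true (hQ _ (hleafQ b h)).2.2 h
    · by_cases h' : b.val < t + t
      · exact iff_of_false (hP _ (hleafP b h h')).2.1 h
      · rw [leafW b h']; exact iff_of_false hu.2 h
  have hadjv : ∀ b, G.Adj v (leaf b) ↔ t ≤ b.val ∧ b.val < t + t := by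
    intro b
    by_cases h : b.val < t
    · exact iff_of_false (hQ _ (hleafQ b h)).2.1 (by omega)
    · by_cases h' : b.val < t + t
      · exact iff_of_true (hP _ (hleafP b h h')).2.2 (by omega)
      · rw [leafW b h']; exact iff_of_false hv.2 (by omega)
  have leafinj : Function.Injective leaf := by
    intro b b' hbb
    have e1 := hadju b
    have e2 := hadjv b
    rw [hbb, hadju] at e1
    rw [hbb, hadjv] at e2
    apply Fin.ext
    by_cases h : b.val < t
    · have h' : b'.val < t := e1.mpr h
      rw [leafQ b h, leafQ b' h'] at hbb
      have := fQ.injective (Subtype.ext hbb)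
      simpa using this
    · by_cases h2 : b.val < t + t
      · have h3 : ¬ b'.val < t := by omega
        have h4 : b'.val < t + t := by omega
        rw [leafP b h h2, leafP b' h3 h4] at hbb
        have := fP.injective (Subtype.ext hbb)
        simp at this
        omega
      · omega
  have huv : u ≠ v := by
    intro h
    have := (hadju ⟨0, by omega⟩).mpr (by simp; omega)
    rw [h, hadjv] at this
    simp at this
    omega
  have same : ∀ x y, c x = c y → ¬ G.Adj x y := fun x y h h' => c.valid h' h
  have hll : ∀ b b', ¬ G.Adj (leaf b) (leaf b') := by
    intro b b'
    apply same
    have a := hcol b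
    have b := hcol b'
    omega
  let φ : Fin 2 ⊕ Fin (t + t + 1) → Fin n := fun x =>
    match x with
    | Sum.inl a => if a = 0 then u else v
    | Sum.inr b => leaf b
  have hcenter : ∀ a, c (φ (Sum.inl a)) = c u := by
    intro a
    change c (if a = 0 then u else v) = c u
    split_ifs
    · rfl
    · exact hc.symm
  have hφ : Function.Injective φ := by
    rintro (a | b) (a' | b') h
    · have h' : (if a = 0 then u else v) = (if a' = 0 then u else v) := h
      have : a = a' := by
        split_ifs at h' with h3 h4 h4
        · rw [h3, h4]
        · exact absurd h' huv
        · exact absurd h'.symm huv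
        · omega
      rw [this]
    · exact absurd ((hcenter a).symm.trans (congrArg c h)) (hcol b')
    · exact absurd ((hcenter a').symm.trans (congrArg c h.symm)) (hcol b)
    · rw [leafinj h]
  apply hF
  refine ⟨⟨⟨φ, hφ⟩, ?_⟩⟩
  rintro (a | b) (a' | b')
  · have : ¬ G.Adj (φ (Sum.inl a)) (φ (Sum.inl a')) := by
      apply same
      rw [hcenter, hcenter]
    simpa [Ftp] using this
  · fin_cases a <;> simp [Ftp, φ, hadju, hadjv]
  · fin_cases a' <;> simp [Ftp, φ, hadju, hadjv, G.adj_comm (leaf b)]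
  · have := hll b b'
    simpa [Ftp, φ] using this

/-- the decoder on tuples: `inl 0 … inl 6` are the vertex, its side, class, partner class,
position, rank and threshold -/
def tupleDec (t : ℕ) (f g : Fin 7 ⊕ (Fin (2 * t) ⊕ Fin (2 * t)) → ℕ) : Prop :=
  f (Sum.inl 1) ≠ g (Sum.inl 1) ∧ ¬ (
    (f (Sum.inl 3) = g (Sum.inl 2) ∧ f (Sum.inl 5) ≤ g (Sum.inl 5) ∧
      (f (Sum.inl 6) ≤ g (Sum.inl 4) ↔ ¬ ∃ i, f (Sum.inr (Sum.inr i)) = g (Sum.inl 0))) ∨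
    (f (Sum.inl 3) = g (Sum.inl 2) ∧ ¬ f (Sum.inl 5) ≤ g (Sum.inl 5) ∧
      (g (Sum.inl 6) ≤ f (Sum.inl 4) ↔ ¬ ∃ i, g (Sum.inr (Sum.inr i)) = f (Sum.inl 0))) ∨
    (f (Sum.inl 3) ≠ g (Sum.inl 2) ∧ ((∃ i, f (Sum.inr (Sum.inl i)) = g (Sum.inl 0)) ∨
      ∃ i, g (Sum.inr (Sum.inl i)) = f (Sum.inl 0))))

/-- For `t ≥ 2`, the class of `F_{t,t}`-free bipartite graphs admits an implicit
representation. -/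
theorem statement8 (t : ℕ) (ht : 2 ≤ t) :
    AdmitsImplicit (fun n G => G.Colorable 2 ∧ ¬ Nonempty (Ftp t t ↪g G)) := by
  classical
  apply admits_of_tuples _ (tupleDec t) _ (Sum.inl 0)
  rintro n hn G ⟨⟨c⟩, hF⟩
  let A : Fin n → Fin n → Prop := fun u v => c u ≠ c v ∧ ¬ G.Adj u v
  have hs : ∀ u v, A u v → A v u := fun u v h => ⟨h.1.symm, fun h' => h.2 h'.symm⟩
  let deg : Fin n → ℕ := fun u => Finset.card {w | A u w}
  let pos : Fin n → ℕ := fun u => u.val + n * deg u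
  have hdiv : ∀ u, pos u / n = deg u := by
    intro u
    simp only [pos]
    rw [Nat.add_mul_div_left _ _ (by omega), Nat.div_eq_of_lt u.isLt, zero_add]
  have hmod : ∀ u, pos u % n = u.val := by
    intro u
    simp only [pos]
    rw [Nat.add_mul_mod_self_left, Nat.mod_eq_of_lt u.isLt]
  have hinj : Function.Injective pos := by
    intro u v h
    apply Fin.ext
    rw [← hmod, ← hmod, h]
  have hdeg : ∀ u, deg u ≤ n := by
    intro u
    have := Finset.card_le_univ ({w | A u w} : Finset (Fin n))
    simpa using this
  have hposlt : ∀ u, pos u + 1 < n ^ 3 := by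
    intro u
    have h1 := hdeg u
    have h2 := u.isLt
    have h3 : n * deg u ≤ n * n := Nat.mul_le_mul_left _ h1
    simp only [pos]
    have h4 : 2 * (n * n) ≤ n ^ 3 := by
      have : n ^ 3 = n * (n * n) := by ring
      rw [this]
      exact Nat.mul_le_mul_right _ hn
    nlinarith
  have hN : Nest A t pos := by
    rintro u v hle ⟨w, hw1, hw2⟩
    by_contra hcon0
    have hcon := Nat.le_of_not_lt hcon0
    have hd : deg u ≤ deg v := by
      rw [← hdiv, ← hdiv]
      exact Nat.div_le_div_right hle
    have key : ∀ x y, Finset.card {z | A x z ∧ A y z} + Finset.card {z | A x z ∧ ¬ A y z} = deg x := by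
      intro x y
      have := Finset.card_filter_add_card_filter_not (s := ({z | A x z} : Finset (Fin n)))
        (fun z => A y z)
      simpa only [Finset.filter_filter] using this
    have k1 := key u v
    have k2 := key v u
    have k3 : Finset.card {z | A u z ∧ A v z} = Finset.card {z | A v z ∧ A u z} := by
      simp only [and_comm]
    refine nest_of_free ht G c hF u v w hw1 hw2 (by convert hcon) ?_
    have : Finset.card {z | A u z ∧ ¬ A v z} ≤ Finset.card {z | A v z ∧ ¬ A u z} := by omega
    have hcon' : t ≤ Finset.card {z | A u z ∧ ¬ A v z} := by convert hcon
    have h9 := hcon'.trans this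
    convert h9
  obtain ⟨q, nq, L, E, rank, s, hL, hE, hrank, hsb, hA⟩ := core_rep hs hinj hN
  choose l hl1 hl2 using fun v => exists_list (L v) (hL v)
  choose e he1 he2 using fun v => exists_list (E v) (hE v)
  have hn3 : n < n ^ 3 := by
    calc n = n ^ 1 := (pow_one n).symm
      _ < n ^ 3 := Nat.pow_lt_pow_right (by omega) (by omega)
  refine ⟨fun v => Sum.elim ![v.val, (c v).val, (q v).val, (nq v).val, pos v, rank v, s v]
    (Sum.elim (l v) (e v)), ?_, ?_, ?_⟩
  · rintro v (i | i | i)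
    · have a0 := v.isLt
      have a1 := (c v).isLt
      have a2 := (q v).isLt
      have a3 := (nq v).isLt
      have a4 := hposlt v
      have a5 := hrank v
      obtain ⟨u, hu⟩ := hsb v
      have a6 := hposlt u
      rw [Fintype.card_fin] at a5
      fin_cases i <;> simp <;> omega
    · exact (hl1 v i).trans_lt hn3
    · exact (he1 v i).trans_lt hn3
  · intro v
    rfl
  · intro u v huv
    have hGA : G.Adj u v ↔ (c u).val ≠ (c v).val ∧ ¬ A u v := by
      simp only [A, ne_eq, Fin.val_inj]
      constructor
      · intro h
        have := c.valid h
        tauto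
      · tauto
    rw [hGA, hA u v huv]
    simp only [hl2, he2, ← Fin.val_inj, ne_eq]
    exact Iff.rfl
end

section
/- The class of S_{2,2,2}-free chordal bipartite finite graphs admits an implicit representation. -/
open SimpleGraph

/-- The tree `S_{2,2,2}`: the claw `K_{1,3}` with every edge subdivided once
(center `0`, paths `0-1-2`, `0-3-4`, `0-5-6`). -/
def S222 : SimpleGraph (Fin 7) :=
  SimpleGraph.fromRel fun i j =>
    ((i : ℕ), (j : ℕ)) ∈ [(0,1),(1,2),(0,3),(3,4),(0,5),(5,6)]

/-- Chordal bipartite: bipartite with no induced cycle of length 6 or more. -/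
def ChordalBipartite {V : Type*} (G : SimpleGraph V) : Prop :=
  G.Colorable 2 ∧ ∀ m : ℕ, 6 ≤ m → ¬ Nonempty (SimpleGraph.cycleGraph m ↪g G)

set_option linter.unusedSimpArgs false

/-- no bipartite complement of a perfect matching on `3 + 3` (that is, no induced `C₆`). -/
def NoC6 {α β : Type*} (E : α → β → Prop) : Prop :=
  ∀ a1 a2 a3 b1 b2 b3, ¬ (¬ E a1 b1 ∧ E a1 b2 ∧ E a1 b3 ∧ E a2 b1 ∧ ¬ E a2 b2 ∧ E a2 b3 ∧
    E a3 b1 ∧ E a3 b2 ∧ ¬ E a3 b3)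

/-- no induced `3 K₂`. -/
def No3K2 {α β : Type*} (E : α → β → Prop) : Prop :=
  ∀ a1 a2 a3 b1 b2 b3, ¬ (E a1 b1 ∧ ¬ E a1 b2 ∧ ¬ E a1 b3 ∧ ¬ E a2 b1 ∧ E a2 b2 ∧ ¬ E a2 b3 ∧
    ¬ E a3 b1 ∧ ¬ E a3 b2 ∧ E a3 b3)

/-- no induced `C₈`. -/
def NoC8 {α β : Type*} (E : α → β → Prop) : Prop :=
  ∀ a1 a2 a3 a4 b1 b2 b3 b4,
    ¬ (E a1 b1 ∧ E a1 b2 ∧ ¬ E a1 b3 ∧ ¬ E a1 b4 ∧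
       ¬ E a2 b1 ∧ E a2 b2 ∧ E a2 b3 ∧ ¬ E a2 b4 ∧
       ¬ E a3 b1 ∧ ¬ E a3 b2 ∧ E a3 b3 ∧ E a3 b4 ∧
       E a4 b1 ∧ ¬ E a4 b2 ∧ ¬ E a4 b3 ∧ E a4 b4)

theorem dom_aux {α β : Type*} {E : α → β → Prop} (h6 : NoC6 E) (h8 : NoC8 E)
    {a0 a1 a2 a3 : α} {b0 b1 b2 b3 : β}
    (e0 : E a0 b0) (e1 : E a1 b1) (e2 : E a2 b2) (e3 : E a3 b3)
    (n01 : ¬ E a0 b1) (n10 : ¬ E a1 b0) (n23 : ¬ E a2 b3) (n32 : ¬ E a3 b2)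
    (l02 : E a0 b2 ∨ E a2 b0) (l03 : E a0 b3 ∨ E a3 b0)
    (l12 : E a1 b2 ∨ E a2 b1) (l13 : E a1 b3 ∨ E a3 b1) :
    (E a0 b2 ∧ E a0 b3 ∧ E a1 b2 ∧ E a1 b3) ∨ (E a2 b0 ∧ E a2 b1 ∧ E a3 b0 ∧ E a3 b1) := by
  have := h6 a0 a1 a2 b1 b0 b3
  have := h6 a0 a1 a3 b1 b0 b2
  have := h6 a0 a2 a3 b1 b3 b2
  have := h6 a1 a2 a3 b0 b3 b2
  have := h6 a0 a1 a2 b1 b2 b3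
  have := h6 a0 a1 a2 b2 b0 b3
  have := h6 a0 a1 a3 b1 b3 b2
  have := h6 a0 a1 a3 b3 b0 b2
  have := h6 a0 a2 a3 b1 b0 b2
  have := h6 a0 a2 a3 b1 b3 b0
  have := h6 a1 a2 a3 b0 b1 b2
  have := h6 a1 a2 a3 b0 b3 b1
  have := h8 a0 a2 a1 a3 b0 b2 b1 b3
  have := h8 a0 a2 a1 a3 b3 b0 b2 b1
  simp only [e0, e1, e2, e3, n01, n10, n23, n32, true_and, and_true, not_true_eq_false,
    not_false_eq_true, and_false, false_and] at *
  clear h6 h8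
  grind (splits := 30)

theorem five_aux {α β : Type*} {E : α → β → Prop} (h6 : NoC6 E) (h8 : NoC8 E) (h3 : No3K2 E)
    {a0 a1 a2 a3 a4 : α} {b0 b1 b2 b3 b4 : β}
    (e0 : E a0 b0) (e1 : E a1 b1) (e2 : E a2 b2) (e3 : E a3 b3) (e4 : E a4 b4)
    (n01 : ¬ E a0 b1) (n10 : ¬ E a1 b0) (n12 : ¬ E a1 b2) (n21 : ¬ E a2 b1)
    (n23 : ¬ E a2 b3) (n32 : ¬ E a3 b2) (n34 : ¬ E a3 b4) (n43 : ¬ E a4 b3)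
    (n40 : ¬ E a4 b0) (n04 : ¬ E a0 b4)
    (l02 : E a0 b2 ∨ E a2 b0) (l13 : E a1 b3 ∨ E a3 b1) (l24 : E a2 b4 ∨ E a4 b2)
    (l30 : E a3 b0 ∨ E a0 b3) (l41 : E a4 b1 ∨ E a1 b4) : False := by
  have := h6 a0 a1 a2 b4 b0 b3
  have := h6 a0 a3 a4 b1 b2 b0
  have := h6 a0 a1 a4 b1 b2 b3
  have := h6 a1 a2 a3 b0 b1 b4
  have := h3 a0 a1 a2 b3 b1 b2
  have := h3 a0 a1 a4 b0 b3 b4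
  have := h8 a0 a2 a4 a3 b3 b2 b4 b1
  have := h8 a1 a3 a2 a4 b4 b3 b0 b2
  have := h3 a0 a3 a4 b0 b1 b4
  have := h3 a1 a2 a3 b1 b2 b0
  have := h8 a0 a2 a1 a3 b0 b2 b4 b1
  have := h8 a0 a1 a4 a2 b0 b3 b1 b2
  have := h6 a0 a3 a4 b1 b2 b3
  have := h6 a1 a2 a3 b0 b3 b4
  have := h3 a1 a2 a3 b4 b2 b3
  have := h3 a2 a3 a4 b2 b3 b1
  have := h6 a0 a1 a4 b4 b2 b3
  have := h6 a2 a3 a4 b1 b4 b0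
  have := h3 a0 a1 a2 b0 b1 b4
  have := h6 a0 a1 a2 b4 b2 b3
  have := h3 a0 a1 a4 b0 b1 b2
  have := h3 a0 a2 a4 b3 b2 b1
  have := h3 a1 a2 a3 b4 b2 b0
  have := h6 a2 a3 a4 b1 b2 b0
  clear h6 h8 h3
  simp only [e0, e1, e2, e3, e4, n01, n10, n12, n21, n23, n32, n34, n43, n40, n04, true_and,
    and_true, not_true_eq_false, not_false_eq_true, and_false, false_and] at *
  grind (splits := 30)

theorem NoC6.flip {α β : Type*} {E : α → β → Prop} (h : NoC6 E) : NoC6 (flip E) := by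
  intro a1 a2 a3 b1 b2 b3 H
  have := h b1 b2 b3 a1 a2 a3
  simp only [_root_.flip] at H
  tauto

theorem NoC8.flip {α β : Type*} {E : α → β → Prop} (h : NoC8 E) : NoC8 (flip E) := by
  intro a1 a2 a3 a4 b1 b2 b3 b4 H
  have := h b2 b3 b4 b1 a1 a2 a3 a4
  simp only [_root_.flip] at H
  tauto

/-- `{i, i+1}` dominates `{j, j+1}`. -/
def Dom {α β : Type*} (E : α → β → Prop) (a : ℕ → α) (b : ℕ → β) (i j : ℕ) : Prop :=
  E (a i) (b j) ∧ E (a i) (b (j + 1)) ∧ E (a (i + 1)) (b j) ∧ E (a (i + 1)) (b (j + 1))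

theorem no_long_dich {α β : Type*} {E : α → β → Prop} (h6 : NoC6 E) (h8 : NoC8 E)
    {m : ℕ} (a : ℕ → α) (b : ℕ → β)
    (e : ∀ i, E (a i) (b i)) (c : ∀ i, ¬ E (a i) (b (i + 1)) ∧ ¬ E (a (i + 1)) (b i))
    (l : ∀ i k, 2 ≤ k → k + 2 ≤ m → E (a i) (b (i + k)) ∨ E (a (i + k)) (b i))
    (i k : ℕ) (h1 : 3 ≤ k) (h2 : k + 3 ≤ m) :
    Dom E a b i (i + k) ∨ Dom E a b (i + k) i := by
  obtain ⟨k, rfl⟩ : ∃ k', k = k' + 1 := ⟨k - 1, by omega⟩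
  have l02 := l i (k + 1) (by omega) (by omega)
  have l03 := l i (k + 2) (by omega) (by omega)
  have l12 := l (i + 1) k (by omega) (by omega)
  have l13 := l (i + 1) (k + 1) (by omega) (by omega)
  rw [show i + 1 + k = i + (k + 1) by ring] at l12
  rw [show i + 1 + (k + 1) = i + (k + 1) + 1 by ring] at l13
  rw [show i + (k + 2) = i + (k + 1) + 1 by ring] at l03
  exact dom_aux h6 h8 (e i) (e (i + 1)) (e (i + (k + 1))) (e (i + (k + 1) + 1)) (c i).1 (c i).2
    (c _).1 (c _).2 l02 l03 l12 l13

theorem no_long_both {α β : Type*} {E : α → β → Prop} (h6 : NoC6 E)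
    (a : ℕ → α) (b : ℕ → β)
    (e : ∀ i, E (a i) (b i)) (c : ∀ i, ¬ E (a i) (b (i + 1)) ∧ ¬ E (a (i + 1)) (b i))
    (i j : ℕ) (h1 : Dom E a b i j) (h2 : Dom E a b j i) : False := by
  have := h6 (a i) (a (i + 1)) (a j) (b (i + 1)) (b i) (b (j + 1))
  have := e i
  have := e (i + 1)
  have := c i
  have := c j
  unfold Dom at *
  tauto

theorem no_long_aux {α β : Type*} {E : α → β → Prop} (h6 : NoC6 E) (h8 : NoC8 E)
    {m : ℕ} (hm : 7 ≤ m) (a : ℕ → α) (b : ℕ → β)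
    (pa : ∀ i, a (i + m) = a i) (pb : ∀ i, b (i + m) = b i)
    (e : ∀ i, E (a i) (b i)) (c : ∀ i, ¬ E (a i) (b (i + 1)) ∧ ¬ E (a (i + 1)) (b i))
    (l : ∀ i k, 2 ≤ k → k + 2 ≤ m → E (a i) (b (i + k)) ∨ E (a (i + k)) (b i))
    (h0 : Dom E a b 0 3) : False := by
  have dich := no_long_dich h6 h8 a b e c l
  have shiftj : ∀ i k, 3 ≤ k → k + 4 ≤ m → Dom E a b i (i + k) → Dom E a b i (i + (k + 1)) := by
    intro i k h1 h2 hD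
    rcases dich i (k + 1) (by omega) (by omega) with h | h
    · exact h
    · exfalso
      rw [← add_assoc] at h
      have := h6 (a i) (a (i + 1)) (a (i + k + 1)) (b (i + 1)) (b i) (b (i + k))
      have := e i
      have := e (i + 1)
      have := c i
      have := c (i + k)
      unfold Dom at *
      tauto
  have shifti : ∀ i k, 3 ≤ k → k + 4 ≤ m → Dom E a b i (i + (k + 1)) →
      Dom E a b (i + 1) (i + 1 + k) := by
    intro i k h1 h2 hD
    rcases dich (i + 1) k (by omega) (by omega) with h | h
    · exact h
    · exfalso
      rw [show i + (k + 1) = i + 1 + k by ring] at hD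
      have := h6 (a (i + 1 + k)) (a (i + 1 + k + 1)) (a i) (b (i + 1 + k + 1)) (b (i + 1 + k))
        (b (i + 1))
      have := e (i + 1 + k)
      have := e (i + 1 + k + 1)
      have := c i
      have := c (i + 1 + k)
      unfold Dom at *
      tauto
  have all3 : ∀ i, Dom E a b i (i + 3) := by
    intro i
    induction i with
    | zero => simpa using h0
    | succ i ih => exact shifti i 3 le_rfl (by omega) (shiftj i 3 le_rfl (by omega) ih)
  have all0 : ∀ k, 3 ≤ k → k + 3 ≤ m → Dom E a b 0 (0 + k) := by
    intro k hk
    induction k, hk using Nat.le_induction with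
    | base => intro _; simpa using h0
    | succ k hk ih => intro h; exact shiftj 0 k hk (by omega) (ih (by omega))
  have d1 := all0 (m - 3) (by omega) (by omega)
  have d2 := all3 (m - 3)
  rw [show m - 3 + 3 = 0 + m by omega] at d2
  rw [zero_add] at d1
  refine no_long_both h6 a b e c 0 (m - 3) d1 ?_
  unfold Dom at d2 ⊢
  rwa [show 0 + m + 1 = (0 + 1) + m by ring, pb, pb] at d2

theorem no_long {α β : Type*} {E : α → β → Prop} (h6 : NoC6 E) (h8 : NoC8 E)
    {m : ℕ} (hm : 7 ≤ m) (a : ℕ → α) (b : ℕ → β)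
    (pa : ∀ i, a (i + m) = a i) (pb : ∀ i, b (i + m) = b i)
    (e : ∀ i, E (a i) (b i)) (c : ∀ i, ¬ E (a i) (b (i + 1)) ∧ ¬ E (a (i + 1)) (b i))
    (l : ∀ i k, 2 ≤ k → k + 2 ≤ m → E (a i) (b (i + k)) ∨ E (a (i + k)) (b i)) : False := by
  rcases no_long_dich h6 h8 a b e c l 0 3 le_rfl (by omega) with h | h
  · exact no_long_aux h6 h8 hm a b pa pb e c l (by simpa using h)
  · refine no_long_aux (E := flip E) h6.flip h8.flip hm b a pb pa e (fun i => (c i).symm)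
      (fun i k h1 h2 => (l i k h1 h2).symm) ?_
    unfold Dom at h ⊢
    simp only [flip, zero_add] at h ⊢
    tauto

/-- Splice: a periodic closed walk from a chord. -/
theorem splice {γ : Type*} {r : γ → γ → Prop} {f : ℕ → γ} (hf : ∀ i, r (f i) (f (i + 1)))
    (i k : ℕ) (h : r (f (i + k)) (f i)) :
    ∃ g : ℕ → γ, (∀ t, r (g t) (g (t + 1))) ∧ ∀ t, g (t + (k + 1)) = g t := by
  refine ⟨fun t => f (i + t % (k + 1)), fun t => ?_, fun t => by simp⟩
  have hlt : t % (k + 1) < k + 1 := Nat.mod_lt t (by omega)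
  rcases Nat.lt_or_ge (t % (k + 1)) k with h1 | h1
  · have : (t + 1) % (k + 1) = t % (k + 1) + 1 := by
      rw [Nat.add_mod, Nat.mod_eq_of_lt (a := 1) (by omega), Nat.mod_eq_of_lt (by omega)]
    simp only [this]
    exact hf _
  · have h2 : t % (k + 1) = k := by omega
    have : (t + 1) % (k + 1) = 0 := by
      rw [← Nat.mod_add_div t (k + 1), h2, show k + (k + 1) * (t / (k + 1)) + 1 = (k + 1) * (t / (k + 1) + 1) by ring]
      simp
    simp only [this, h2]
    simpa using h

theorem no_odd {α β : Type*} {E : α → β → Prop} (h6 : NoC6 E) (h8 : NoC8 E) (h3 : No3K2 E)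
    (m : ℕ) (hm : Odd m) (f : ℕ → {p : α × β // E p.1 p.2}) (pf : ∀ i, f (i + m) = f i)
    (c : ∀ i, ¬ E (f i).1.1 (f (i + 1)).1.2 ∧ ¬ E (f (i + 1)).1.1 (f i).1.2) : False := by
  induction m using Nat.strong_induction_on generalizing f with
  | _ m ih =>
  have key : ∀ i k, 2 ≤ k → k + 2 ≤ m → Even k →
      E (f i).1.1 (f (i + k)).1.2 ∨ E (f (i + k)).1.1 (f i).1.2 := by
    intro i k h1 h2 hk
    by_contra hcon
    push Not at hcon
    obtain ⟨g, hg, hp⟩ := splice (r := fun x y : {p : α × β // E p.1 p.2} =>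
      ¬ E x.1.1 y.1.2 ∧ ¬ E y.1.1 x.1.2) c i k hcon.symm
    exact ih (k + 1) (by omega) hk.add_one g hp hg
  have key2 : ∀ i k, 2 ≤ k → k + 2 ≤ m →
      E (f i).1.1 (f (i + k)).1.2 ∨ E (f (i + k)).1.1 (f i).1.2 := by
    intro i k h1 h2
    rcases Nat.even_or_odd k with hk | hk
    · exact key i k h1 h2 hk
    · have := key (i + k) (m - k) (by omega) (by omega) (Nat.Odd.sub_odd hm hk)
      rw [show i + k + (m - k) = i + m by omega, pf] at this
      exact this.symm
  have e : ∀ i, E (f i).1.1 (f i).1.2 := fun i => (f i).2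
  rcases Nat.lt_or_ge m 7 with h | h
  · have : m = 1 ∨ m = 3 ∨ m = 5 := by
      rcases hm with ⟨t, rfl⟩; omega
    rcases this with rfl | rfl | rfl
    · have := (c 0).1
      rw [pf] at this
      exact this (e 0)
    · have h01 := c 0
      have h12 := c 1
      have h20 := c 2
      rw [show 2 + 1 = 0 + 3 by rfl, pf] at h20
      exact h3 _ _ _ _ _ _ ⟨e 0, h01.1, h20.2, h01.2, e 1, h12.1, h20.1, h12.2, e 2⟩
    · have c0 := c 0
      have c1 := c 1
      have c2 := c 2
      have c3 := c 3
      have c4 := c 4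
      rw [show 4 + 1 = 0 + 5 by rfl, pf] at c4
      have k3 := key2 3 2 (by omega) (by omega)
      have k4 := key2 4 2 (by omega) (by omega)
      rw [show 3 + 2 = 0 + 5 by rfl, pf] at k3
      rw [show 4 + 2 = 1 + 5 by rfl, pf] at k4
      exact five_aux h6 h8 h3 (e 0) (e 1) (e 2) (e 3) (e 4) c0.1 c0.2 c1.1 c1.2 c2.1 c2.2 c3.1 c3.2
        c4.1 c4.2 (key2 0 2 (by omega) (by omega)) (key2 1 2 (by omega) (by omega))
        (key2 2 2 (by omega) (by omega)) k3 k4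
  · exact no_long h6 h8 h (fun i => (f i).1.1) (fun i => (f i).1.2) (fun i => by simp only [pf])
      (fun i => by simp only [pf]) e c key2

/-- Two-colouring of the conflict graph. -/
theorem two_col {α β : Type*} {E : α → β → Prop} (h6 : NoC6 E) (h8 : NoC8 E) (h3 : No3K2 E) :
    ∃ col : {p : α × β // E p.1 p.2} → Fin 2, ∀ x y, ¬ E x.1.1 y.1.2 → ¬ E y.1.1 x.1.2 →
      col x ≠ col y := by
  let K : SimpleGraph {p : α × β // E p.1 p.2} :=
    { Adj := fun x y => ¬ E x.1.1 y.1.2 ∧ ¬ E y.1.1 x.1.2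
      symm := ⟨fun x y h => h.symm⟩
      loopless := ⟨fun x h => h.1 x.2⟩ }
  have hK : K.Colorable 2 := by
    rw [SimpleGraph.two_colorable_iff_forall_loop_even]
    intro u w
    by_contra hodd
    rw [Nat.not_even_iff_odd] at hodd
    have hpos : 0 < w.length := hodd.pos
    have hw : ∀ i, i < w.length → K.Adj (w.getVert i) (w.getVert (i + 1)) :=
      fun i hi => w.adj_getVert_succ hi
    refine no_odd h6 h8 h3 w.length hodd (fun i => w.getVert (i % w.length)) (fun i => by simp)
      (fun i => ?_)
    have hlt := Nat.mod_lt i hpos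
    have h1 := hw _ hlt
    rcases Nat.lt_or_ge (i % w.length + 1) w.length with h2 | h2
    · have : (i + 1) % w.length = i % w.length + 1 := by
        rw [Nat.add_mod, Nat.mod_eq_of_lt (a := 1) (by omega), Nat.mod_eq_of_lt h2]
      simp only [this]
      exact h1
    · have h3 : i % w.length + 1 = w.length := by omega
      have : (i + 1) % w.length = 0 := by
        rw [← Nat.mod_add_div i w.length, add_right_comm, h3]
        simp
      simp only [this]
      rw [h3] at h1
      simpa using h1
  obtain ⟨C⟩ := hK
  exact ⟨C, fun x y h1 h2 => C.valid ⟨h1, h2⟩⟩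

theorem cyc_of_transGen {γ : Type*} {r : γ → γ → Prop} {x y : γ} (h : Relation.TransGen r x y) :
    ∃ k, ∃ f : ℕ → γ, f 0 = x ∧ f (k + 1) = y ∧ ∀ i ≤ k, r (f i) (f (i + 1)) := by
  induction h with
  | single h => exact ⟨0, fun i => if i = 0 then x else _, by simp, by simp; rfl, fun i hi => by
      obtain rfl : i = 0 := by omega
      simpa using h⟩
  | @tail b c hab hbc ih =>
    obtain ⟨k, f, h0, h1, h2⟩ := ih
    refine ⟨k + 1, fun i => if i ≤ k + 1 then f i else c, by simpa using h0, by simp, ?_⟩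
    intro i hi
    rcases Nat.lt_or_ge i (k + 1) with h | h
    · have h3 : i ≤ k + 1 := by omega
      have h4 : i + 1 ≤ k + 1 := by omega
      simp only [h3, h4, if_true]
      exact h2 i (by omega)
    · obtain rfl : i = k + 1 := by omega
      simp only [le_refl, if_true]
      rw [if_neg (by omega), h1]
      exact hbc

theorem no_alt {α β : Type*} {E : α → β → Prop} (h6 : NoC6 E)
    (F : {p : α × β // E p.1 p.2} → Prop)
    (hF : ∀ x y, F x → F y → E x.1.1 y.1.2 ∨ E y.1.1 x.1.2)
    (m : ℕ) (f : ℕ → {p : α × β // E p.1 p.2}) (pf : ∀ i, f (i + (m + 1)) = f i)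
    (c : ∀ i, F (f i) ∧ F (f (i + 1)) ∧ ¬ E (f i).1.1 (f (i + 1)).1.2) : False := by
  induction m using Nat.strong_induction_on generalizing f with
  | _ m ih =>
  have key : ∀ i k, 1 ≤ k → k < m → E (f (i + k)).1.1 (f i).1.2 := by
    intro i k h1 h2
    by_contra hcon
    obtain ⟨g, hg, hp⟩ := splice (r := fun x y : {p : α × β // E p.1 p.2} =>
      F x ∧ F y ∧ ¬ E x.1.1 y.1.2) c i k ⟨(c _).1, (c _).1, hcon⟩
    exact ih k h2 g hp hg
  have e : ∀ i, E (f i).1.1 (f i).1.2 := fun i => (f i).2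
  have key2 : ∀ i k, 2 ≤ k → k ≤ m → E (f i).1.1 (f (i + k)).1.2 := by
    intro i k h1 h2
    have := key (i + k) (m + 1 - k) (by omega) (by omega)
    rwa [show i + k + (m + 1 - k) = i + (m + 1) by omega, pf] at this
  rcases Nat.lt_or_ge m 2 with h | h
  · interval_cases m
    · have := (c 0).2.2
      rw [pf] at this
      exact this (e 0)
    · have h0 := (c 0).2.2
      have h1 := (c 1).2.2
      rw [show 1 + 1 = 0 + (1 + 1) by rfl, pf] at h1
      rcases hF _ _ (c 0).1 (c 1).1 with h | h
      · exact h0 h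
      · exact h1 h
  · refine h6 (f 0).1.1 (f 1).1.1 (f 2).1.1 (f 1).1.2 (f 2).1.2 (f 3).1.2
      ⟨(c 0).2.2, key2 0 2 (by omega) (by omega), ?_, e 1, (c 1).2.2, key2 1 2 le_rfl h, ?_, e 2,
        (c 2).2.2⟩
    · rcases Nat.lt_or_ge m 3 with h' | h'
      · obtain rfl : m = 2 := by omega
        have h30 : f 3 = f 0 := pf 0
        rw [h30]
        exact e 0
      · exact key2 0 3 (by omega) h'
    · have := hF _ _ (c 1).1 (c 2).1
      rcases this with h' | h'
      · exact absurd h' (c 1).2.2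
      · exact h'

theorem bip_thresholds {α β : Type*} [Fintype α] [Fintype β] {E : α → β → Prop} (h6 : NoC6 E)
    (h8 : NoC8 E) (h3 : No3K2 E) :
    ∃ (σ : Fin 2 → α → ℕ) (τ : Fin 2 → β → ℕ),
      (∀ a b, E a b ↔ ∃ c, τ c b ≤ σ c a) ∧
      (∀ c a, σ c a ≤ Fintype.card α * Fintype.card β + 1) ∧
      (∀ c b, τ c b ≤ Fintype.card α * Fintype.card β + 2) := by
  classical
  obtain ⟨col, hcol⟩ := two_col h6 h8 h3
  let r : Fin 2 → {p : α × β // E p.1 p.2} → {p : α × β // E p.1 p.2} → Prop :=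
    fun c x y => col x = c ∧ col y = c ∧ ¬ E x.1.1 y.1.2
  have hirr : ∀ c x, ¬ Relation.TransGen (r c) x x := by
    intro c x h
    obtain ⟨k, f, h0, h1, h2⟩ := cyc_of_transGen h
    have hex : ∃ g : ℕ → _, (∀ t, r c (g t) (g (t + 1))) ∧ ∀ t, g (t + (k + 1)) = g t := by
      refine ⟨fun t => f (t % (k + 1)), fun t => ?_, fun t => by simp⟩
      have hlt : t % (k + 1) < k + 1 := Nat.mod_lt t (by omega)
      have h3 := h2 (t % (k + 1)) (by omega)
      rcases Nat.lt_or_ge (t % (k + 1)) k with h4 | h4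
      · have : (t + 1) % (k + 1) = t % (k + 1) + 1 := by
          rw [Nat.add_mod, Nat.mod_eq_of_lt (a := 1) (by omega), Nat.mod_eq_of_lt (by omega)]
        simp only [this]
        exact h3
      · have h5 : t % (k + 1) = k := by omega
        have : (t + 1) % (k + 1) = 0 := by
          rw [← Nat.mod_add_div t (k + 1), h5,
            show k + (k + 1) * (t / (k + 1)) + 1 = (k + 1) * (t / (k + 1) + 1) by ring]
          simp
        simp only [this, h0]
        rw [h5] at h3 ⊢
        rwa [h1] at h3
    obtain ⟨g, hg, hp⟩ := hex
    refine no_alt h6 (fun x => col x = c) ?_ k g hp hg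
    intro x y hx hy
    by_contra hcon
    push Not at hcon
    exact hcol x y hcon.1 hcon.2 (hx.trans hy.symm)
  let h : Fin 2 → {p : α × β // E p.1 p.2} → ℕ :=
    fun c x => (Finset.univ.filter fun y => Relation.TransGen (r c) y x).card + 1
  have hmono : ∀ c x y, r c x y → h c x < h c y := by
    intro c x y hxy
    simp only [h, add_lt_add_iff_right]
    apply Finset.card_lt_card
    rw [Finset.ssubset_iff_of_subset]
    · exact ⟨x, by simp [Relation.TransGen.single hxy], by simp [hirr]⟩
    · intro z hz
      simp only [Finset.mem_filter, Finset.mem_univ, true_and] at hz ⊢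
      exact hz.tail hxy
  have hbd : ∀ c x, h c x ≤ Fintype.card α * Fintype.card β + 1 := by
    intro c x
    simp only [h, add_le_add_iff_right]
    refine (Finset.card_le_univ _).trans ?_
    rw [← Fintype.card_prod]
    exact Fintype.card_subtype_le _
  set N := Fintype.card α * Fintype.card β with hN
  refine ⟨fun c a => (Finset.univ.filter fun x : {p : α × β // E p.1 p.2} =>
      x.1.1 = a ∧ col x = c).sup (h c),
    fun c b => N + 2 - (Finset.univ.filter fun x : {p : α × β // E p.1 p.2} =>
      x.1.2 = b ∧ col x = c).sup (fun x => N + 2 - h c x), ?_, ?_, ?_⟩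
  · intro a b
    constructor
    · intro hab
      let x : {p : α × β // E p.1 p.2} := ⟨(a, b), hab⟩
      refine ⟨col x, ?_⟩
      have h1 : h (col x) x ≤ (Finset.univ.filter fun x' : {p : α × β // E p.1 p.2} =>
          x'.1.1 = a ∧ col x' = col x).sup (h (col x)) :=
        Finset.le_sup (f := h (col x)) (by simp [x])
      have h2 : N + 2 - h (col x) x ≤ (Finset.univ.filter fun x' : {p : α × β // E p.1 p.2} =>
          x'.1.2 = b ∧ col x' = col x).sup (fun x' => N + 2 - h (col x) x') :=
        Finset.le_sup (f := fun x' => N + 2 - h (col x) x') (by simp [x])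
      have h4 := hbd (col x) x
      beta_reduce
      omega
    · rintro ⟨c, hc⟩
      beta_reduce at hc
      by_contra hab
      have hpos : ∀ x, 1 ≤ h c x := fun x => by simp [h]
      rcases Finset.eq_empty_or_nonempty (Finset.univ.filter fun x : {p : α × β // E p.1 p.2} =>
          x.1.2 = b ∧ col x = c) with he | hne
      · rw [he] at hc
        have : (Finset.univ.filter fun x : {p : α × β // E p.1 p.2} =>
          x.1.1 = a ∧ col x = c).sup (h c) ≤ N + 1 := Finset.sup_le fun x _ => hbd c x
        rw [Finset.sup_empty, Nat.bot_eq_zero] at hc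
        omega
      · obtain ⟨y, hy, hys⟩ := Finset.exists_mem_eq_sup _ hne (fun x => N + 2 - h c x)
        rw [hys] at hc
        simp only [Finset.mem_filter, Finset.mem_univ, true_and] at hy
        have h5 := hbd c y
        have h6 := hpos y
        have : (Finset.univ.filter fun x : {p : α × β // E p.1 p.2} =>
          x.1.1 = a ∧ col x = c).sup (h c) ≤ h c y - 1 := by
          refine Finset.sup_le fun x hx => ?_
          simp only [Finset.mem_filter, Finset.mem_univ, true_and] at hx
          have := hmono c x y ⟨hx.2, hy.2, by rw [hx.1, hy.1]; exact hab⟩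
          omega
        omega
  · intro c a
    exact Finset.sup_le fun x _ => hbd c x
  · intro c b
    exact Nat.sub_le _ _

section GraphPart

theorem no_ind_cycle {V : Type*} {G : SimpleGraph V} (hG : ChordalBipartite G) (m : ℕ) (hm : 6 ≤ m)
    (f : ℕ → V)
    (h : ∀ i j, i < j → j < m → (G.Adj (f i) (f j) ↔ j = i + 1 ∨ (i = 0 ∧ j + 1 = m))) : False := by
  have hne : ∀ i j, i < j → j < m → f i ≠ f j := by
    intro i j hij hj he
    rcases Nat.eq_zero_or_pos i with rfl | hi
    · have h1 := (h 0 1 (by omega) (by omega)).2 (Or.inl rfl)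
      rcases Nat.lt_or_ge 1 j with h2 | h2
      · rw [he] at h1
        have h3 := (h 1 j h2 hj).1 h1.symm
        have h4 : j = 2 := by omega
        subst h4
        have h5 := (h 0 (m - 1) (by omega) (by omega)).2 (Or.inr ⟨rfl, by omega⟩)
        rw [he] at h5
        have := (h 2 (m - 1) (by omega) (by omega)).1 h5
        omega
      · have h4 : j = 1 := by omega
        subst h4
        rw [he] at h1
        exact h1.ne rfl
    · have h1 := (h (i - 1) i (by omega) (by omega)).2 (Or.inl (by omega))
      rw [he] at h1
      have h2 := (h (i - 1) j (by omega) hj).1 h1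
      have h3 := (h i (i + 1) (by omega) (by omega)).2 (Or.inl rfl)
      rw [he] at h3
      have := (h (i + 1) j (by omega) hj).1 h3.symm
      omega
  refine hG.2 m hm ⟨⟨⟨fun i => f i.1, ?_⟩, ?_⟩⟩
  · intro i j hij
    by_contra hc
    rcases Nat.lt_or_gt_of_ne (fun h => hc (Fin.ext h)) with h1 | h1
    · exact hne _ _ h1 j.2 hij
    · exact hne _ _ h1 i.2 hij.symm
  · intro i j
    have key : ∀ i j : Fin m, i < j → (G.Adj (f i.1) (f j.1) ↔ (cycleGraph m).Adj i j) := by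
      intro i j hij
      rw [h _ _ hij j.2, cycleGraph_adj', Fin.coe_sub_iff_lt.2 hij, Fin.coe_sub_iff_le.2 hij.le]
      have := Fin.lt_def.1 hij
      have := j.2
      omega
    rcases lt_trichotomy i j with h1 | h1 | h1
    · exact key i j h1
    · subst h1
      simp
    · rw [SimpleGraph.adj_comm, SimpleGraph.adj_comm (cycleGraph m)]
      exact key j i h1

theorem no_S222 {V : Type*} {G : SimpleGraph V} (hG : ¬ Nonempty (S222 ↪g G)) (f : Fin 7 → V)
    (h : ∀ i j, i < j → (G.Adj (f i) (f j) ↔ S222.Adj i j)) : False := by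
  have h' : ∀ i j, (G.Adj (f i) (f j) ↔ S222.Adj i j) := by
    intro i j
    rcases lt_trichotomy i j with h1 | h1 | h1
    · exact h i j h1
    · subst h1
      simp
    · rw [SimpleGraph.adj_comm, SimpleGraph.adj_comm S222]
      exact h j i h1
  refine hG ⟨⟨⟨f, ?_⟩, fun {i j} => h' i j⟩⟩
  intro i j hij
  have h1 : ∀ k, S222.Adj i k ↔ S222.Adj j k := fun k => by rw [← h', ← h', hij]
  have h2 : ∀ i j : Fin 7, (∀ k, S222.Adj i k ↔ S222.Adj j k) → i = j := by
    simp only [S222, SimpleGraph.fromRel_adj]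
    decide
  exact h2 i j h1

/-- Explicit form. -/
theorem no_spider {V : Type*} {G : SimpleGraph V} (hG : ¬ Nonempty (S222 ↪g G)) (c : V)
    (p q : Fin 3 → V) (h1 : ∀ i, G.Adj c (p i)) (h2 : ∀ i, ¬ G.Adj c (q i))
    (h3 : ∀ i j, G.Adj (p i) (q j) ↔ i = j) (h4 : ∀ i j, ¬ G.Adj (p i) (p j))
    (h5 : ∀ i j, ¬ G.Adj (q i) (q j)) : False := by
  refine no_S222 hG ![c, p 0, q 0, p 1, q 1, p 2, q 2] ?_
  intro i j hij
  have h3' : ∀ i j, G.Adj (q j) (p i) ↔ i = j := fun i j => by rw [SimpleGraph.adj_comm, h3]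
  fin_cases i <;> fin_cases j <;> first | (exfalso; revert hij; decide) | 
    simp [S222, h1, h2, h3, h4, h5, h3']

theorem lev_low_aux {V : Type*} {G : SimpleGraph V} {v r : V} (p : G.Walk v r)
    (hp : p.length = G.dist r v) (hv : 0 < G.dist r v) :
    ∃ u, G.Adj v u ∧ G.dist r u + 1 = G.dist r v := by
  cases p with
  | nil => simp at hv
  | @cons _ u _ h q =>
    refine ⟨u, h, ?_⟩
    have h2 := SimpleGraph.dist_le q
    obtain ⟨q', hq'⟩ := q.reachable.symm.exists_walk_length_eq_dist
    have h3 := SimpleGraph.dist_le (q'.concat h.symm)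
    simp only [SimpleGraph.Walk.length_cons, SimpleGraph.Walk.length_concat] at h3 hp
    rw [SimpleGraph.dist_comm] at h2
    omega

structure Lev {n : ℕ} (G : SimpleGraph (Fin n)) (lev : Fin n → ℕ) (root : Fin n → Fin n) : Prop where
  adj : ∀ {u v}, G.Adj u v → lev u = lev v + 1 ∨ lev v = lev u + 1
  low : ∀ v, 0 < lev v → ∃ u, G.Adj u v ∧ lev u + 1 = lev v
  zero : ∀ v, lev v = 0 → root v = v
  root : ∀ {u v}, G.Adj u v → root u = root v
  lt : ∀ v, lev v < n

theorem exists_lev {n : ℕ} (G : SimpleGraph (Fin n)) (hc : G.Colorable 2) :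
    ∃ lev root, Lev G lev root := by
  classical
  let root : Fin n → Fin n := fun v => (G.connectedComponentMk v).out
  have hr : ∀ v, G.Reachable (root v) v := fun v =>
    SimpleGraph.ConnectedComponent.exact (Quot.out_eq _)
  have hroot : ∀ {u v}, G.Adj u v → root u = root v := fun {u v} h => by
    simp only [root]
    rw [SimpleGraph.ConnectedComponent.sound h.reachable]
  refine ⟨fun v => G.dist (root v) v, root, ?_, ?_, ?_, hroot, ?_⟩
  · intro u v h
    have h1 := hroot h
    simp only [h1]
    obtain ⟨p, hp⟩ := (hr v).exists_walk_length_eq_dist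
    obtain ⟨q, hq⟩ := (h1 ▸ hr u : G.Reachable (root v) u).exists_walk_length_eq_dist
    have e := (SimpleGraph.two_colorable_iff_forall_loop_even.1 hc) _ (q.append (.cons h p.reverse))
    simp only [SimpleGraph.Walk.length_append, SimpleGraph.Walk.length_cons,
      SimpleGraph.Walk.length_reverse] at e
    have h2 := SimpleGraph.dist_le (q.concat h)
    have h3 := SimpleGraph.dist_le (p.concat h.symm)
    simp only [SimpleGraph.Walk.length_concat] at h2 h3
    rw [hp, hq] at e
    rcases e with ⟨t, ht⟩
    omega
  · intro v hv
    obtain ⟨p, hp⟩ := (hr v).symm.exists_walk_length_eq_dist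
    rw [SimpleGraph.dist_comm] at hp
    obtain ⟨u, hu, h2⟩ := lev_low_aux p hp hv
    exact ⟨u, hu.symm, by rw [hroot hu.symm]; exact h2⟩
  · intro v hv
    exact ((hr v).dist_eq_zero_iff).1 hv
  · intro v
    obtain ⟨p, hp, hl⟩ := (hr v).exists_path_of_dist
    have := hp.length_lt
    rw [Fintype.card_fin, hl] at this
    exact this

theorem comparab {n : ℕ} {G : SimpleGraph (Fin n)} (hG : ChordalBipartite G) {lev root}
    (hL : Lev G lev root) {y x x' p q : Fin n} (hyx : G.Adj y x) (hyx' : G.Adj y x')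
    (hxp : G.Adj x p) (hxq : ¬ G.Adj x q) (hxp' : ¬ G.Adj x' p) (hxq' : G.Adj x' q)
    (l1 : lev y = lev x + 1) (l2 : lev y = lev x' + 1) (l3 : lev x = lev p + 1)
    (l4 : lev x' = lev q + 1) : False := by
  let T : Fin n → Prop := fun v => lev v < lev p ∨ v = p ∨ v = q
  let G' : SimpleGraph (Fin n) :=
    { Adj := fun a b => G.Adj a b ∧ T a ∧ T b
      symm := ⟨fun a b h => ⟨h.1.symm, h.2.2, h.2.1⟩⟩
      loopless := ⟨fun a h => h.1.ne rfl⟩ }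
  have hTl : ∀ v, T v → lev v ≤ lev p := by
    rintro v (h | rfl | rfl) <;> omega
  have hreach : ∀ k v, lev v = k → T v → G'.Reachable v (root v) := by
    intro k
    induction k with
    | zero => intro v hv _; rw [hL.zero v hv]
    | succ k ih =>
      intro v hv hT
      obtain ⟨u, hu, hl⟩ := hL.low v (by omega)
      have hTu : T u := Or.inl (by have := hTl v hT; omega)
      have := ih u (by omega) hTu
      rw [hL.root hu] at this
      have ha : G'.Adj v u := ⟨hu.symm, hT, hTu⟩
      exact ha.reachable.trans this
  have hTp : T p := Or.inr (Or.inl rfl)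
  have hTq : T q := Or.inr (Or.inr rfl)
  have hpq : G'.Reachable p q := by
    have h1 := hreach _ p rfl hTp
    have h2 := hreach _ q rfl hTq
    rw [← hL.root hxp, ← hL.root hyx] at h1
    rw [← hL.root hxq', ← hL.root hyx'] at h2
    exact h1.trans h2.symm
  obtain ⟨w, hw, hlen⟩ := hpq.exists_path_of_dist
  set k := w.length with hk
  have hpne : p ≠ q := by rintro rfl; exact hxq hxp
  have hinj : ∀ i j, i ≤ k → j ≤ k → w.getVert i = w.getVert j → i = j :=
    fun i j hi hj h => hw.getVert_injOn hi hj h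
  have hadj : ∀ i, i < k → G'.Adj (w.getVert i) (w.getVert (i + 1)) :=
    fun i hi => w.adj_getVert_succ hi
  have hT : ∀ i, i ≤ k → T (w.getVert i) := by
    intro i hi
    rcases Nat.lt_or_ge i k with h | h
    · exact (hadj i h).2.1
    · obtain rfl : i = k := by omega
      rw [hk, w.getVert_length]; exact hTq
  have hind : ∀ i j, i < j → j ≤ k → (G.Adj (w.getVert i) (w.getVert j) ↔ j = i + 1) := by
    intro i j hij hj
    constructor
    · intro h
      have h' : G'.Adj (w.getVert i) (w.getVert j) := ⟨h, hT i (by omega), hT j hj⟩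
      have := SimpleGraph.dist_le ((w.take i).append (.cons h' (w.drop j)))
      simp only [SimpleGraph.Walk.length_append, SimpleGraph.Walk.length_cons,
        SimpleGraph.Walk.take_length, SimpleGraph.Walk.drop_length] at this
      omega
    · rintro rfl
      exact (hadj i (by omega)).1
  have hk2 : 2 ≤ k := by
    by_contra hcon
    have h0 : w.getVert 0 = p := w.getVert_zero
    have h1 : w.getVert k = q := w.getVert_length
    rcases Nat.lt_or_ge k 1 with h | h
    · obtain h : k = 0 := by omega
      rw [h, h0] at h1
      exact hpne h1
    · have h : k = 1 := by omega
      have := (hadj 0 (by omega)).1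
      rw [h] at h1
      rw [h0, zero_add, h1] at this
      have := hL.adj this
      omega
  have hmid : ∀ i, 0 < i → i < k → lev (w.getVert i) < lev p := by
    intro i h1 h2
    rcases hT i h2.le with h | h | h
    · exact h
    · have := hinj i 0 h2.le (by omega) (by rw [h, w.getVert_zero])
      omega
    · have := hinj i k h2.le (by omega) (by rw [h, w.getVert_length])
      omega
  have h0 : w.getVert 0 = p := w.getVert_zero
  have hkk : w.getVert k = q := w.getVert_length
  refine no_ind_cycle hG (k + 4) (by omega) (fun i => if i ≤ k then w.getVert i else
    if i = k + 1 then x' else if i = k + 2 then y else x) ?_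
  intro i j hij hj
  have hy : ∀ i ≤ k, ¬ G.Adj (w.getVert i) y := by
    intro i hi h
    have := hL.adj h
    have := hTl _ (hT i hi)
    omega
  rcases Nat.lt_or_ge k i with hi | hi
  · have : (i = k + 1 ∧ j = k + 2) ∨ (i = k + 1 ∧ j = k + 3) ∨ (i = k + 2 ∧ j = k + 3) := by omega
    rcases this with ⟨rfl, rfl⟩ | ⟨rfl, rfl⟩ | ⟨rfl, rfl⟩
    · simp [hyx'.symm]
    · have : ¬ G.Adj x' x := fun h => by have := hL.adj h; omega
      simp [this]
    · simp [hyx]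
  · rcases Nat.lt_or_ge k j with hj' | hj'
    · have hi' : i = 0 ∨ i = k ∨ (0 < i ∧ i < k) := by omega
      have : j = k + 1 ∨ j = k + 2 ∨ j = k + 3 := by omega
      rcases this with rfl | rfl | rfl
      · rcases hi' with rfl | rfl | ⟨h1, h2⟩
        · have : ¬ G.Adj p x' := fun h => hxp' h.symm
          simp [h0, this]
          omega
        · simp [hkk, hxq'.symm]
        · have h3 : ¬ G.Adj (w.getVert i) x' := fun h => by
            have := hL.adj h
            have := hmid i h1 h2
            omega
          simp [hi, h3]
          omega
      · have := hy i hi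
        simp [hi, this]
        omega
      · rcases hi' with rfl | rfl | ⟨h1, h2⟩
        · simp [h0, hxp.symm]
        · have : ¬ G.Adj q x := fun h => hxq h.symm
          simp [hkk, this]
          omega
        · have h3 : ¬ G.Adj (w.getVert i) x := fun h => by
            have := hL.adj h
            have := hmid i h1 h2
            omega
          simp [hi, h3]
          omega
    · simp only [hi, hj', if_true]
      rw [hind i j hij hj']
      omega


theorem exists_minS {n : ℕ} {G : SimpleGraph (Fin n)} {lev root} (hL : Lev G lev root) :
    ∃ S : Finset (Fin n), (∀ v, 0 < lev v → ∃ s ∈ S, G.Adj s v ∧ lev s + 1 = lev v) ∧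
      ∀ s ∈ S, ∃ x, G.Adj s x ∧ lev s + 1 = lev x ∧
        ∀ t ∈ S, G.Adj t x → lev t + 1 = lev x → t = s := by
  classical
  obtain ⟨S, hS, hmin⟩ := Finset.exists_min_image (Finset.univ.filter fun S : Finset (Fin n) =>
    ∀ v, 0 < lev v → ∃ s ∈ S, G.Adj s v ∧ lev s + 1 = lev v) Finset.card
    ⟨Finset.univ, by simpa using hL.low⟩
  simp only [Finset.mem_filter, Finset.mem_univ, true_and] at hS hmin
  refine ⟨S, hS, fun s hs => ?_⟩
  by_contra hcon
  push Not at hcon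
  have := hmin (S.erase s) ?_
  · have h2 := Finset.card_erase_lt_of_mem hs
    omega
  · intro v hv
    obtain ⟨t, ht, hadj, hl⟩ := hS v hv
    by_cases hts : t = s
    · subst hts
      obtain ⟨t', h1, h2, h3, h4⟩ := hcon v hadj hl
      exact ⟨t', Finset.mem_erase.2 ⟨h4, h1⟩, h2, h3⟩
    · exact ⟨t, Finset.mem_erase.2 ⟨hts, ht⟩, hadj, hl⟩

theorem at_most_two {n : ℕ} {G : SimpleGraph (Fin n)} (hS : ¬ Nonempty (S222 ↪g G)) {lev root}
    (hL : Lev G lev root) {S : Finset (Fin n)}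
    (hpriv : ∀ s ∈ S, ∃ x, G.Adj s x ∧ lev s + 1 = lev x ∧
        ∀ t ∈ S, G.Adj t x → lev t + 1 = lev x → t = s)
    {v : Fin n} (s : Fin 3 → Fin n) (h1 : ∀ i, s i ∈ S) (h2 : ∀ i, G.Adj (s i) v)
    (h3 : ∀ i, lev (s i) + 1 = lev v) (hinj : Function.Injective s) : False := by
  choose x hx1 hx2 hx3 using fun i => hpriv (s i) (h1 i)
  refine no_spider hS v s x (fun i => (h2 i).symm) ?_ ?_ ?_ ?_
  · intro i h
    have := hL.adj h
    have := hx2 i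
    have := h3 i
    omega
  · intro i j
    constructor
    · intro h
      have e1 := hx2 j
      have e2 := h3 i
      have e3 := h3 j
      exact hinj (hx3 j (s i) (h1 i) h (by omega))
    · rintro rfl
      exact hx1 i
  · intro i j h
    have := hL.adj h
    have := h3 i
    have := h3 j
    omega
  · intro i j h
    have := hL.adj h
    have := h3 i
    have := h3 j
    have := hx2 i
    have := hx2 j
    omega

theorem exists_two {n : ℕ} {G : SimpleGraph (Fin n)} (hS : ¬ Nonempty (S222 ↪g G)) {lev root}
    (hL : Lev G lev root) {S : Finset (Fin n)}
    (hdom : ∀ v, 0 < lev v → ∃ s ∈ S, G.Adj s v ∧ lev s + 1 = lev v)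
    (hpriv : ∀ s ∈ S, ∃ x, G.Adj s x ∧ lev s + 1 = lev x ∧
        ∀ t ∈ S, G.Adj t x → lev t + 1 = lev x → t = s) (v : Fin n) :
    ∃ s1 s2, 0 < lev v → (G.Adj s1 v ∧ lev s1 + 1 = lev v) ∧ (G.Adj s2 v ∧ lev s2 + 1 = lev v) ∧
      ∀ t ∈ S, G.Adj t v → lev t + 1 = lev v → t = s1 ∨ t = s2 := by
  rcases Nat.eq_zero_or_pos (lev v) with h0 | h0
  · exact ⟨v, v, fun h => by omega⟩
  obtain ⟨s1, hs1, ha1, hl1⟩ := hdom v h0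
  by_cases hex : ∃ s2 ∈ S, s2 ≠ s1 ∧ G.Adj s2 v ∧ lev s2 + 1 = lev v
  · obtain ⟨s2, hs2, hne, ha2, hl2⟩ := hex
    refine ⟨s1, s2, fun _ => ⟨⟨ha1, hl1⟩, ⟨ha2, hl2⟩, fun t ht ha hl => ?_⟩⟩
    by_contra hcon
    push Not at hcon
    refine at_most_two hS hL hpriv (v := v) ![s1, s2, t] ?_ ?_ ?_ ?_
    · intro i; fin_cases i <;> assumption
    · intro i; fin_cases i <;> assumption
    · intro i; fin_cases i <;> assumption
    · intro i j hij
      fin_cases i <;> fin_cases j <;> simp_all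
  · push Not at hex
    refine ⟨s1, s1, fun _ => ⟨⟨ha1, hl1⟩, ⟨ha1, hl1⟩, fun t ht ha hl => ?_⟩⟩
    by_contra hcon
    exact hex t ht (fun h => hcon (Or.inl h)) ha hl

theorem exists_p {n : ℕ} {G : SimpleGraph (Fin n)} (hG : ChordalBipartite G) {lev root}
    (hL : Lev G lev root) {S : Finset (Fin n)}
    (hdom : ∀ v, 0 < lev v → ∃ s ∈ S, G.Adj s v ∧ lev s + 1 = lev v) (y : Fin n) :
    ∃ p, 2 ≤ lev y → p ∈ S ∧ lev p + 2 = lev y ∧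
      ∀ x, G.Adj x y → lev x + 1 = lev y → G.Adj p x := by
  classical
  rcases Nat.lt_or_ge (lev y) 2 with h0 | h0
  · exact ⟨y, fun h => by omega⟩
  let N : Fin n → Finset (Fin n) := fun x => Finset.univ.filter fun q => G.Adj x q ∧ lev x = lev q + 1
  obtain ⟨x, hx, hmin⟩ := Finset.exists_min_image
    (Finset.univ.filter fun x => G.Adj x y ∧ lev x + 1 = lev y) (fun x => (N x).card)
    (by obtain ⟨u, h1, h2⟩ := hL.low y (by omega); exact ⟨u, by simp [h1, h2]⟩)
  simp only [Finset.mem_filter, Finset.mem_univ, true_and] at hx hmin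
  obtain ⟨s, hs, hsx, hl⟩ := hdom x (by omega)
  refine ⟨s, fun _ => ⟨hs, by omega, fun x' hx' hl' => ?_⟩⟩
  by_contra hcon
  have hsub : N x' ⊆ N x := by
    intro q hq
    simp only [N, Finset.mem_filter, Finset.mem_univ, true_and] at hq ⊢
    refine ⟨?_, by omega⟩
    by_contra hxq
    exact comparab hG hL hx.1.symm hx'.symm hsx.symm hxq (fun h => hcon h.symm) hq.1
      (by omega) (by omega) (by omega) hq.2
  have hlt : N x' ⊂ N x := by
    rw [Finset.ssubset_iff_of_subset hsub]
    refine ⟨s, ?_, ?_⟩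
    · simp only [N, Finset.mem_filter, Finset.mem_univ, true_and]
      exact ⟨hsx.symm, by omega⟩
    · simp only [N, Finset.mem_filter, Finset.mem_univ, true_and]
      exact fun h => hcon h.1.symm
  have h1 := Finset.card_lt_card hlt
  have h2 := hmin x' ⟨hx', hl'⟩
  omega

section SRel
variable {n : ℕ} {G : SimpleGraph (Fin n)} {lev : Fin n → ℕ} {root : Fin n → Fin n}

/-- The bipartite relation at `s`. -/
def SRel (G : SimpleGraph (Fin n)) (lev : Fin n → ℕ) (p : Fin n → Fin n) (s x y : Fin n) : Prop :=
  G.Adj s x ∧ lev x = lev s + 1 ∧ p y = s ∧ lev y = lev s + 2 ∧ G.Adj x y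

theorem rel_sides (hL : Lev G lev root) {p : Fin n → Fin n} {s : Fin n} {A B : Finset (Fin n)}
    (hA : ∀ a ∈ A, ∃ y, SRel G lev p s a y) (hB : ∀ b ∈ B, ∃ x, SRel G lev p s x b) :
    (∀ a ∈ A, ∀ a' ∈ A, ¬ G.Adj a a') ∧ (∀ b ∈ B, ∀ b' ∈ B, ¬ G.Adj b b') ∧
    (∀ a ∈ A, ∀ b ∈ B, (G.Adj a b ↔ SRel G lev p s a b)) := by
  refine ⟨fun a ha a' ha' h => ?_, fun b hb b' hb' h => ?_, fun a ha b hb => ?_⟩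
  · obtain ⟨_, h1⟩ := hA a ha
    obtain ⟨_, h2⟩ := hA a' ha'
    have := hL.adj h
    have := h1.2.1
    have := h2.2.1
    omega
  · obtain ⟨_, h1⟩ := hB b hb
    obtain ⟨_, h2⟩ := hB b' hb'
    have := hL.adj h
    have := h1.2.2.2.1
    have := h2.2.2.2.1
    omega
  · obtain ⟨_, h1⟩ := hA a ha
    obtain ⟨_, h2⟩ := hB b hb
    exact ⟨fun h => ⟨h1.1, h1.2.1, h2.2.2.1, h2.2.2.2.1, h⟩, fun h => h.2.2.2.2⟩

theorem rel_no3K2 (hS : ¬ Nonempty (S222 ↪g G)) (hL : Lev G lev root) (p : Fin n → Fin n)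
    (s : Fin n) : No3K2 (SRel G lev p s) := by
  rintro a1 a2 a3 b1 b2 b3 ⟨h11, h12, h13, h21, h22, h23, h31, h32, h33⟩
  obtain ⟨hA, hB, hAB⟩ := rel_sides hL (p := p) (s := s) (A := {a1, a2, a3}) (B := {b1, b2, b3})
    (by simp only [Finset.mem_insert, Finset.mem_singleton]
        rintro a (rfl | rfl | rfl)
        exacts [⟨_, h11⟩, ⟨_, h22⟩, ⟨_, h33⟩])
    (by simp only [Finset.mem_insert, Finset.mem_singleton]
        rintro a (rfl | rfl | rfl)
        exacts [⟨_, h11⟩, ⟨_, h22⟩, ⟨_, h33⟩])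
  refine no_spider hS s ![a1, a2, a3] ![b1, b2, b3] ?_ ?_ ?_ ?_ ?_
  · intro i; fin_cases i
    exacts [h11.1, h22.1, h33.1]
  · intro i h
    have := hL.adj h
    have e1 := h11.2.2.2.1
    have e2 := h22.2.2.2.1
    have e3 := h33.2.2.2.1
    fin_cases i <;> simp at this <;> omega
  · intro i j
    rw [hAB _ (by fin_cases i <;> simp) _ (by fin_cases j <;> simp)]
    fin_cases i <;> fin_cases j <;> simp [*]
  · intro i j
    exact hA _ (by fin_cases i <;> simp) _ (by fin_cases j <;> simp)
  · intro i j
    exact hB _ (by fin_cases i <;> simp) _ (by fin_cases j <;> simp)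

theorem rel_noC6 (hG : ChordalBipartite G) (hL : Lev G lev root) (p : Fin n → Fin n)
    (s : Fin n) : NoC6 (SRel G lev p s) := by
  rintro a1 a2 a3 b1 b2 b3 ⟨h11, h12, h13, h21, h22, h23, h31, h32, h33⟩
  obtain ⟨hA, hB, hAB⟩ := rel_sides hL (p := p) (s := s) (A := {a1, a2, a3}) (B := {b1, b2, b3})
    (by simp only [Finset.mem_insert, Finset.mem_singleton]
        rintro a (rfl | rfl | rfl)
        exacts [⟨_, h12⟩, ⟨_, h21⟩, ⟨_, h31⟩])
    (by simp only [Finset.mem_insert, Finset.mem_singleton]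
        rintro a (rfl | rfl | rfl)
        exacts [⟨_, h21⟩, ⟨_, h12⟩, ⟨_, h13⟩])
  have hBA : ∀ b ∈ ({b1, b2, b3} : Finset (Fin n)), ∀ a ∈ ({a1, a2, a3} : Finset (Fin n)),
      (G.Adj b a ↔ SRel G lev p s a b) := fun b hb a ha => by
    rw [SimpleGraph.adj_comm]; exact hAB a ha b hb
  simp only [Finset.mem_insert, Finset.mem_singleton, forall_eq_or_imp, forall_eq] at hA hB hAB hBA
  -- cycle a1 b2 a3 b1 a2 b3
  refine no_ind_cycle hG 6 le_rfl (fun i => if i = 0 then a1 else if i = 1 then b2 else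
    if i = 2 then a3 else if i = 3 then b1 else if i = 4 then a2 else b3) ?_
  intro i j hij hj
  interval_cases j <;> interval_cases i <;> simp [*]

theorem rel_noC8 (hG : ChordalBipartite G) (hL : Lev G lev root) (p : Fin n → Fin n)
    (s : Fin n) : NoC8 (SRel G lev p s) := by
  rintro a1 a2 a3 a4 b1 b2 b3 b4 ⟨h11, h12, h13, h14, h21, h22, h23, h24, h31, h32, h33, h34,
    h41, h42, h43, h44⟩
  obtain ⟨hA, hB, hAB⟩ := rel_sides hL (p := p) (s := s) (A := {a1, a2, a3, a4})
    (B := {b1, b2, b3, b4})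
    (by simp only [Finset.mem_insert, Finset.mem_singleton]
        rintro a (rfl | rfl | rfl | rfl)
        exacts [⟨_, h11⟩, ⟨_, h22⟩, ⟨_, h33⟩, ⟨_, h44⟩])
    (by simp only [Finset.mem_insert, Finset.mem_singleton]
        rintro a (rfl | rfl | rfl | rfl)
        exacts [⟨_, h11⟩, ⟨_, h22⟩, ⟨_, h33⟩, ⟨_, h44⟩])
  have hBA : ∀ b ∈ ({b1, b2, b3, b4} : Finset (Fin n)),
      ∀ a ∈ ({a1, a2, a3, a4} : Finset (Fin n)),
      (G.Adj b a ↔ SRel G lev p s a b) := fun b hb a ha => by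
    rw [SimpleGraph.adj_comm]; exact hAB a ha b hb
  simp only [Finset.mem_insert, Finset.mem_singleton, forall_eq_or_imp, forall_eq] at hA hB hAB hBA
  -- cycle b1 a1 b2 a2 b3 a3 b4 a4
  refine no_ind_cycle hG 8 (by omega) (fun i => if i = 0 then b1 else if i = 1 then a1 else
    if i = 2 then b2 else if i = 3 then a2 else if i = 4 then b3 else if i = 5 then a3 else
    if i = 6 then b4 else a4) ?_
  intro i j hij hj
  interval_cases j <;> interval_cases i <;> simp [*]

end SRel

/-- The one-sided decoding relation. -/
def Half (u v : Fin 12 → ℕ) : Prop :=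
  v 1 = u 1 + 1 ∧ ((u 1 = 0 ∧ v 2 = u 0) ∨ (1 ≤ u 1 ∧
    ((v 3 = u 4 ∧ (v 10 ≤ u 6 ∨ v 11 ≤ u 7)) ∨ (v 3 = u 5 ∧ (v 10 ≤ u 8 ∨ v 11 ≤ u 9)))))

theorem scheme {n : ℕ} (hn : 2 ≤ n) (G : SimpleGraph (Fin n)) (hG : ChordalBipartite G)
    (hS : ¬ Nonempty (S222 ↪g G)) :
    ∃ fld : Fin n → Fin 12 → ℕ, (∀ v, fld v 0 = v.1) ∧ (∀ v i, fld v i < n ^ 3) ∧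
      ∀ u v, G.Adj u v ↔ Half (fld u) (fld v) ∨ Half (fld v) (fld u) := by
  obtain ⟨lev, root, hL⟩ := exists_lev G hG.1
  obtain ⟨S, hdom, hpriv⟩ := exists_minS hL
  choose s1 s2 hs using exists_two hS hL hdom hpriv
  choose p hp using exists_p hG hL hdom
  choose σ τ hE hσ hτ using fun s => bip_thresholds (rel_noC6 hG hL p s) (rel_noC8 hG hL p s)
    (rel_no3K2 hS hL p s)
  have hpar : ∀ v, ∃ u, 0 < lev v → G.Adj u v ∧ lev u + 1 = lev v := by
    intro v
    rcases Nat.eq_zero_or_pos (lev v) with h | h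
    · exact ⟨v, fun h' => by omega⟩
    · obtain ⟨u, hu⟩ := hL.low v h
      exact ⟨u, fun _ => hu⟩
  choose par hpar using hpar
  have hEiff : ∀ s a b, SRel G lev p s a b ↔ (τ s 0 b ≤ σ s 0 a ∨ τ s 1 b ≤ σ s 1 a) := by
    intro s a b
    rw [hE s a b, Fin.exists_fin_two]
  let fld : Fin n → Fin 12 → ℕ := fun v => ![v.1, lev v, (par v).1, (p v).1, (s1 v).1, (s2 v).1,
    σ (s1 v) 0 v, σ (s1 v) 1 v, σ (s2 v) 0 v, σ (s2 v) 1 v, τ (p v) 0 v, τ (p v) 1 v]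
  have hhalf : ∀ u v, Half (fld u) (fld v) ↔ G.Adj u v ∧ lev v = lev u + 1 := by
    intro u v
    have e : Half (fld u) (fld v) ↔ lev v = lev u + 1 ∧ ((lev u = 0 ∧ (par v).1 = u.1) ∨
        (1 ≤ lev u ∧ (((p v).1 = (s1 u).1 ∧ (τ (p v) 0 v ≤ σ (s1 u) 0 u ∨
          τ (p v) 1 v ≤ σ (s1 u) 1 u)) ∨ ((p v).1 = (s2 u).1 ∧ (τ (p v) 0 v ≤ σ (s2 u) 0 u ∨
          τ (p v) 1 v ≤ σ (s2 u) 1 u))))) := Iff.rfl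
    rw [e]
    simp only [← Fin.ext_iff]
    constructor
    · rintro ⟨h1, ⟨h2, h3⟩ | ⟨h2, ⟨h3, h4⟩ | ⟨h3, h4⟩⟩⟩
      · have := hpar v (by omega)
        rw [h3] at this
        exact ⟨this.1, h1⟩
      · rw [h3, ← hEiff] at h4
        exact ⟨h4.2.2.2.2, h1⟩
      · rw [h3, ← hEiff] at h4
        exact ⟨h4.2.2.2.2, h1⟩
    · rintro ⟨h1, h2⟩
      refine ⟨h2, ?_⟩
      rcases Nat.eq_zero_or_pos (lev u) with h3 | h3
      · left
        refine ⟨h3, ?_⟩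
        obtain ⟨h4, h5⟩ := hpar v (by omega)
        rw [← hL.zero u h3, ← hL.zero (par v) (by omega), hL.root h4, hL.root h1]
      · right
        refine ⟨h3, ?_⟩
        obtain ⟨h4, h5, h6⟩ := hp v (by omega)
        obtain ⟨-, -, h7⟩ := hs u h3
        have hR : SRel G lev p (p v) u v := ⟨h6 u h1 h2.symm, by omega, rfl, by omega, h1⟩
        have hR' := (hEiff _ _ _).1 hR
        rcases h7 (p v) h4 (h6 u h1 h2.symm) (by omega) with h8 | h8
        · left
          refine ⟨h8, ?_⟩
          rw [← h8]
          exact hR'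
        · right
          refine ⟨h8, ?_⟩
          rw [← h8]
          exact hR'
  refine ⟨fld, fun v => rfl, ?_, ?_⟩
  · have hn3 : n * n + 2 < n ^ 3 := by nlinarith [Nat.mul_le_mul hn hn]
    have hn1 : n ≤ n ^ 3 := Nat.le_self_pow (by omega) n
    have hF : ∀ w : Fin n, w.1 < n ^ 3 := fun w => lt_of_lt_of_le w.2 hn1
    have hσ' : ∀ s c a, σ s c a < n ^ 3 := fun s c a => by
      have := hσ s c a
      simp only [Fintype.card_fin] at this
      omega
    have hτ' : ∀ s c a, τ s c a < n ^ 3 := fun s c a => by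
      have := hτ s c a
      simp only [Fintype.card_fin] at this
      omega
    intro v i
    fin_cases i
    exacts [hF _, lt_of_lt_of_le (hL.lt v) hn1, hF _, hF _, hF _, hF _, hσ' _ _ _, hσ' _ _ _,
      hσ' _ _ _, hσ' _ _ _, hτ' _ _ _, hτ' _ _ _]
  · intro u v
    rw [hhalf, hhalf]
    constructor
    · intro h
      rcases hL.adj h with h1 | h1
      · exact Or.inr ⟨h.symm, h1⟩
      · exact Or.inl ⟨h, h1⟩
    · rintro (h | h)
      · exact h.1
      · exact h.1.symm

theorem exists_encode (K : ℕ) : ∃ e : (Fin K → ℕ) → ℕ, Function.Injective e ∧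
    ∀ N, 1 ≤ N → ∀ f : Fin K → ℕ, (∀ i, f i < N) → e f < N ^ 2 ^ K := by
  induction K with
  | zero => exact ⟨fun _ => 0, fun f g _ => Subsingleton.elim f g, fun N hN f _ => by simp; omega⟩
  | succ K ih =>
    obtain ⟨e, he, hb⟩ := ih
    refine ⟨fun f => Nat.pair (f 0) (e (Fin.tail f)), ?_, ?_⟩
    · intro f g h
      simp only [Nat.pair_eq_pair] at h
      rw [← Fin.cons_self_tail f, ← Fin.cons_self_tail g, h.1, he h.2]
    · intro N hN f hf
      have h1 := hb N hN (Fin.tail f) (fun i => hf _)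
      have h2 : f 0 < N ^ 2 ^ K := lt_of_lt_of_le (hf 0) (Nat.le_self_pow (by positivity) N)
      have h3 := Nat.pair_lt_max_add_one_sq (f 0) (e (Fin.tail f))
      have h4 : max (f 0) (e (Fin.tail f)) + 1 ≤ N ^ 2 ^ K := max_lt h2 h1
      calc _ < _ := h3
        _ ≤ (N ^ 2 ^ K) ^ 2 := Nat.pow_le_pow_left h4 2
        _ = N ^ 2 ^ (K + 1) := by rw [← pow_mul, pow_succ 2 K]

end GraphPart

/-- The class of `S_{2,2,2}`-free chordal bipartite graphs admits an implicit
representation. -/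
theorem statement11 :
    AdmitsImplicit (fun n G => ChordalBipartite G ∧ ¬ Nonempty (S222 ↪g G)) := by
  obtain ⟨e, he, hb⟩ := exists_encode 12
  refine ⟨3 * 2 ^ 12, fun l1 l2 => ∃ f g, e f = l1 ∧ e g = l2 ∧ (Half f g ∨ Half g f), ?_⟩
  rintro n hn G ⟨hG, hS⟩
  obtain ⟨fld, h0, h1, h2⟩ := scheme hn G hG hS
  refine ⟨fun v => ⟨e (fld v), ?_⟩, ?_, ?_⟩
  · have := hb (n ^ 3) (Nat.one_le_pow _ _ (by omega)) (fld v) (h1 v)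
    rwa [← pow_mul] at this
  · intro u v huv
    have h3 := he (Fin.mk.inj_iff.1 huv)
    apply Fin.ext
    rw [← h0, ← h0, h3]
  · intro u v _
    rw [h2]
    constructor
    · intro h
      exact ⟨_, _, rfl, rfl, h⟩
    · rintro ⟨f, g, hf, hg, h⟩
      rw [he hf, he hg] at h
      exact h
end

section
/- For every finite chain graph H, the class of H-free chordal bipartite finite graphs admits an implicit representation. -/
open SimpleGraph

/-- `2K₂`: the disjoint union of two edges. -/
def twoK2 : SimpleGraph (Fin 4) :=
  SimpleGraph.fromRel fun i j => ((i : ℕ), (j : ℕ)) ∈ [(0,1),(2,3)]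

set_option linter.all false

/-- No induced cycle of length at least 6. -/
def NoLong {V : Type*} (G : SimpleGraph V) : Prop :=
  ∀ m : ℕ, 6 ≤ m → ¬ Nonempty (SimpleGraph.cycleGraph m ↪g G)

/-- No half-graph pattern of order `k`. -/
def ZFree {V : Type*} (k : ℕ) (G : SimpleGraph V) : Prop :=
  ¬ ∃ a b : Fin k → V, ∀ i j, G.Adj (a i) (b j) ↔ i ≤ j

theorem cycle_of_path {V : Type*} (G : SimpleGraph V) (w : ℕ → V) (b : V) (l : ℕ) (hl : 4 ≤ l)
    (hadj : ∀ s t, s ≤ l → t ≤ l → (G.Adj (w s) (w t) ↔ s + 1 = t ∨ t + 1 = s))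
    (hinj : ∀ s t, s ≤ l → t ≤ l → w s = w t → s = t)
    (hb : ∀ s, s ≤ l → (G.Adj b (w s) ↔ s = 0 ∨ s = l))
    (hbne : ∀ s, s ≤ l → b ≠ w s) : ¬ NoLong G := by
  intro hno
  refine hno (l + 2) (by omega) ⟨⟨⟨fun i => if i.val ≤ l then w i.val else b, ?_⟩, ?_⟩⟩
  · intro i j hij
    have hi := i.isLt
    have hj := j.isLt
    apply Fin.ext
    dsimp only at hij
    split_ifs at hij with h1 h2 h2
    · exact hinj _ _ h1 h2 hij
    · exact absurd hij.symm (hbne _ h1)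
    · exact absurd hij (hbne _ h2)
    · omega
  · intro i j
    have hi := i.isLt
    have hj := j.isLt
    have key : ∀ i j : Fin (l + 2), ((i - j : Fin (l + 2)).val = 1 ↔
        (i.val = j.val + 1 ∨ (i.val = 0 ∧ j.val = l + 1))) := by
      intro i j
      have hi := i.isLt
      have hj := j.isLt
      rw [Fin.sub_def]
      dsimp only
      by_cases h : j.val ≤ i.val
      · rw [show l + 2 - j.val + i.val = (i.val - j.val) + (l + 2) by omega, Nat.add_mod_right,
          Nat.mod_eq_of_lt (by omega)]
        omega
      · rw [Nat.mod_eq_of_lt (by omega)]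
        omega
    rw [SimpleGraph.cycleGraph_adj', key, key]
    change G.Adj (if i.val ≤ l then w i.val else b) (if j.val ≤ l then w j.val else b) ↔ _
    split_ifs with h1 h2 h2
    · rw [hadj _ _ h1 h2]; omega
    · rw [G.adj_comm, hb _ h1]; omega
    · rw [hb _ h2]; omega
    · simp only [SimpleGraph.irrefl, false_iff]; omega

theorem exists_layers {V : Type*} (G : SimpleGraph V) (col : V → Bool)
    (hcol : ∀ u v, G.Adj u v → col u ≠ col v) :
    ∃ (root : V → V) (L : V → ℕ),
      (∀ u v, G.Adj u v → L u = L v + 1 ∨ L v = L u + 1) ∧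
      (∀ u, 0 < L u → ∃ v, G.Adj u v ∧ L v + 1 = L u) ∧
      (∀ u v, G.Adj u v → root u = root v) ∧
      (∀ u, L u = 0 → u = root u) ∧ (∀ u, L (root u) = 0) := by
  classical
  let root : V → V := fun u => (G.connectedComponentMk u).out
  have hroot : ∀ u, G.Reachable (root u) u := by
    intro u
    apply SimpleGraph.ConnectedComponent.exact
    exact Quot.out_eq _
  have hadjroot : ∀ u v, G.Adj u v → root u = root v := by
    intro u v h
    have : G.connectedComponentMk u = G.connectedComponentMk v :=
      SimpleGraph.ConnectedComponent.sound h.reachable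
    simp only [root, this]
  let c : G.Coloring Bool := SimpleGraph.Coloring.mk col (fun {u v} h => hcol u v h)
  refine ⟨root, fun u => G.dist (root u) u, ?_, ?_, hadjroot, ?_, ?_⟩
  · intro u v h
    have e := hadjroot u v h
    obtain ⟨p, hp⟩ := (hroot u).exists_walk_length_eq_dist
    obtain ⟨q, hq⟩ := (hroot v).exists_walk_length_eq_dist
    have h1 := c.even_length_iff_congr p
    have h2 := c.even_length_iff_congr q
    have h3 := hcol u v h
    have h4 : G.dist (root u) u ≠ G.dist (root v) v := by
      intro h5
      rw [hp, h5, ← hq, h2, e] at h1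
      change ((col (root v) = true) ↔ (col v = true)) ↔ ((col (root v) = true) ↔ (col u = true)) at h1
      revert h1 h3
      cases col u <;> cases col v <;> cases col (root v) <;> simp
    have h5 := SimpleGraph.Adj.diff_dist_adj (u := root u) h
    dsimp only
    rw [← e] at h4 ⊢
    omega
  · intro u hu
    obtain ⟨p, hp⟩ := (hroot u).exists_walk_length_eq_dist
    dsimp only at hu ⊢
    have hlt : p.length - 1 < p.length := by omega
    have h := p.adj_getVert_succ hlt
    rw [show p.length - 1 + 1 = p.length by omega, p.getVert_length] at h
    refine ⟨_, h.symm, ?_⟩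
    rw [hadjroot _ _ h]
    have h1 := SimpleGraph.dist_le (p.take (p.length - 1))
    rw [SimpleGraph.Walk.take_length] at h1
    have h5 := SimpleGraph.Adj.diff_dist_adj (u := root u) h
    omega
  · intro u hu
    exact ((hroot u).dist_eq_zero_iff.1 hu).symm
  · intro u
    have e : root (root u) = root u := by
      have : G.connectedComponentMk (root u) = G.connectedComponentMk u := Quot.out_eq _
      change (G.connectedComponentMk (root u)).out = root u
      rw [this]
    change G.dist (root (root u)) (root u) = 0
    rw [e, SimpleGraph.dist_self]

theorem common_down {V : Type*} (G : SimpleGraph V) (hno : NoLong G) (root : V → V) (L : V → ℕ)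
    (h1 : ∀ u v, G.Adj u v → L u = L v + 1 ∨ L v = L u + 1)
    (h2 : ∀ u, 0 < L u → ∃ v, G.Adj u v ∧ L v + 1 = L u)
    (h3 : ∀ u v, G.Adj u v → root u = root v)
    (h4 : ∀ u, L u = 0 → u = root u)
    (col : V → Bool) (hcol : ∀ u v, G.Adj u v → col u ≠ col v)
    (i : ℕ) (hi : 1 ≤ i) (a a' b : V) (ha : L a = i) (ha' : L a' = i) (hb : L b = i + 1)
    (hab : G.Adj a b) (hab' : G.Adj a' b) : ∃ p, L p + 1 = i ∧ G.Adj a p ∧ G.Adj a' p := by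
  classical
  by_cases hne : a = a'
  · subst hne
    obtain ⟨v, hv, hL⟩ := h2 a (by omega)
    exact ⟨v, by omega, hv, hv⟩
  let S : V → Prop := fun u => L u < i ∨ u = a ∨ u = a'
  let K : SimpleGraph V :=
    { Adj := fun u v => G.Adj u v ∧ S u ∧ S v
      symm := ⟨fun u v h => ⟨h.1.symm, h.2.2, h.2.1⟩⟩
      loopless := ⟨fun u h => G.irrefl h.1⟩ }
  have hdown : ∀ n u, L u = n → S u → K.Reachable u (root u) := by
    intro n
    induction n with
    | zero => intro u hu _; rw [← h4 u hu]
    | succ n ih =>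
      intro u hu hS
      obtain ⟨v, hv, hL⟩ := h2 u (by omega)
      have hvS : S v := by
        left
        rcases hS with h | h | h
        · omega
        · rw [h] at hL; omega
        · rw [h] at hL; omega
      have : K.Adj u v := ⟨hv, hS, hvS⟩
      rw [h3 u v hv]
      exact this.reachable.trans (ih v (by omega) hvS)
  have hSa : S a := Or.inr (Or.inl rfl)
  have hSa' : S a' := Or.inr (Or.inr rfl)
  have hreach : K.Reachable a a' := by
    have e : root a = root a' := (h3 _ _ hab).trans (h3 _ _ hab').symm
    have r1 := hdown _ a rfl hSa
    have r2 := hdown _ a' rfl hSa'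
    rw [e] at r1
    exact r1.trans r2.symm
  obtain ⟨p, hp⟩ := hreach.exists_walk_length_eq_dist
  have hd : ∀ s, s ≤ p.length → K.dist a (p.getVert s) = s := by
    intro s hs
    have e1 := SimpleGraph.dist_le (p.take s)
    have e2 := SimpleGraph.dist_le (p.drop s)
    rw [SimpleGraph.Walk.take_length] at e1
    rw [SimpleGraph.Walk.drop_length] at e2
    have e3 : K.dist a a' ≤ K.dist a (p.getVert s) + K.dist (p.getVert s) a' :=
      SimpleGraph.Reachable.dist_triangle_left ⟨p.take s⟩ a'
    omega
  have hinj : ∀ s t, s ≤ p.length → t ≤ p.length → p.getVert s = p.getVert t → s = t := by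
    intro s t hs ht h
    rw [← hd s hs, ← hd t ht, h]
  have h0 : p.getVert 0 = a := p.getVert_zero
  have hl : p.getVert p.length = a' := p.getVert_length
  have hpos : 0 < p.length := by
    rcases Nat.eq_zero_or_pos p.length with h | h
    · rw [h, h0] at hl; exact absurd hl hne
    · exact h
  have hS : ∀ s, s ≤ p.length → S (p.getVert s) := by
    intro s hs
    rcases Nat.lt_or_ge s p.length with h | h
    · exact (p.adj_getVert_succ h).2.1
    · rw [show s = p.length by omega, hl]; exact hSa'
  have hadj : ∀ s t, s ≤ p.length → t ≤ p.length →
      (G.Adj (p.getVert s) (p.getVert t) ↔ s + 1 = t ∨ t + 1 = s) := by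
    intro s t hs ht
    constructor
    · intro h
      have hK : K.Adj (p.getVert s) (p.getVert t) := ⟨h, hS s hs, hS t ht⟩
      have e := SimpleGraph.Adj.diff_dist_adj (u := a) hK
      rw [hd s hs, hd t ht] at e
      have : s ≠ t := by rintro rfl; exact G.irrefl h
      omega
    · rintro (rfl | rfl)
      · exact (p.adj_getVert_succ (by omega)).1
      · exact (p.adj_getVert_succ (by omega)).1.symm
  have hmid : ∀ s, 0 < s → s < p.length → L (p.getVert s) < i := by
    intro s hs hs'
    rcases hS s hs'.le with h | h | h
    · exact h
    · have := hinj _ _ hs'.le (Nat.zero_le _) (h.trans h0.symm)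
      omega
    · have := hinj _ _ hs'.le le_rfl (h.trans hl.symm)
      omega
  have heven : Even p.length := by
    let c : K.Coloring Bool := SimpleGraph.Coloring.mk col (fun {u v} h => hcol u v h.1)
    rw [c.even_length_iff_congr p]
    change (col a = true) ↔ (col a' = true)
    have e1 := hcol _ _ hab
    have e2 := hcol _ _ hab'
    revert e1 e2
    cases col a <;> cases col a' <;> cases col b <;> simp
  by_cases hlen : p.length = 2
  · have e1 := (hadj 0 1 (by omega) (by omega)).2 (Or.inl rfl)
    have e2 := (hadj 1 2 (by omega) (by omega)).2 (Or.inl rfl)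
    have e3 := hmid 1 (by omega) (by omega)
    rw [h0] at e1
    rw [← hlen, hl] at e2
    have e4 := h1 _ _ e1
    exact ⟨_, by omega, e1, e2.symm⟩
  · exfalso
    have h4l : 4 ≤ p.length := by
      obtain ⟨r, hr⟩ := heven
      omega
    refine cycle_of_path G p.getVert b p.length h4l hadj hinj ?_ ?_ hno
    · intro s hs
      constructor
      · intro h
        by_contra hcon
        have e1 := hmid s (by omega) (by omega)
        have e2 := h1 _ _ h
        omega
      · rintro (rfl | rfl)
        · rw [h0]; exact hab.symm
        · rw [hl]; exact hab'.symm
    · intro s hs h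
      rcases hS s hs with e | e | e
      · rw [← h] at e; omega
      · rw [← h] at e; rw [e] at hb; omega
      · rw [← h] at e; rw [e] at hb; omega

theorem helly {V : Type*} (G : SimpleGraph V) (hno : NoLong G)
    (col : V → Bool) (hcol : ∀ u v, G.Adj u v → col u ≠ col v) (P : V → Prop) :
    ∀ (n : ℕ) (S : Finset V), S.card = n → S.Nonempty →
      (∀ x ∈ S, ∀ y ∈ S, ∃ p, P p ∧ G.Adj p x ∧ G.Adj p y) →
      ∃ p, P p ∧ ∀ x ∈ S, G.Adj p x := by
  classical
  intro n
  induction n with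
  | zero =>
    intro S hS hne
    rw [Finset.card_eq_zero] at hS
    simp [hS] at hne
  | succ n ih =>
    intro S hS hne hpair
    by_cases hn : n + 1 ≤ 2
    · have : ∃ x ∈ S, ∃ y ∈ S, ∀ z ∈ S, z = x ∨ z = y := by
        have h12 : n = 0 ∨ n = 1 := by omega
        rcases h12 with rfl | rfl
        · obtain ⟨x, rfl⟩ := Finset.card_eq_one.1 hS
          exact ⟨x, by simp, x, by simp, by simp⟩
        · obtain ⟨x, y, _, rfl⟩ := Finset.card_eq_two.1 hS
          exact ⟨x, by simp, y, by simp, by simp⟩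
      obtain ⟨x, hx, y, hy, hz⟩ := this
      obtain ⟨p, hp, hpx, hpy⟩ := hpair x hx y hy
      refine ⟨p, hp, fun z hzS => ?_⟩
      rcases hz z hzS with rfl | rfl
      · exact hpx
      · exact hpy
    · by_contra hcon
      push Not at hcon
      have her : ∀ x ∈ S, ∃ p, P p ∧ (∀ z ∈ S, z ≠ x → G.Adj p z) ∧ ¬ G.Adj p x := by
        intro x hx
        have hc : (S.erase x).card = n := by rw [Finset.card_erase_of_mem hx]; omega
        obtain ⟨p, hp, hpS⟩ := ih (S.erase x) hc (by rw [← Finset.card_pos]; omega)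
          (fun u hu v hv => hpair u (Finset.mem_of_mem_erase hu) v (Finset.mem_of_mem_erase hv))
        have hpS' : ∀ z ∈ S, z ≠ x → G.Adj p z := fun z hz hzx =>
          hpS z (Finset.mem_erase.2 ⟨hzx, hz⟩)
        refine ⟨p, hp, hpS', fun h => ?_⟩
        obtain ⟨z, hz, hzn⟩ := hcon p hp
        by_cases e : z = x
        · rw [e] at hzn; exact hzn h
        · exact hzn (hpS' z hz e)
      obtain ⟨x, y, z, hx, hy, hz, hxy, hxz, hyz⟩ := Finset.two_lt_card_iff.1 (show 2 < S.card by omega)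
      obtain ⟨p, -, hp, hpx⟩ := her x hx
      obtain ⟨q, -, hq, hqy⟩ := her y hy
      obtain ⟨r, -, hr, hrz⟩ := her z hz
      have a1 := hp y hy hxy.symm
      have a2 := hp z hz hxz.symm
      have a3 := hq x hx hxy
      have a4 := hq z hz hyz.symm
      have a5 := hr x hx hxz
      have a6 := hr y hy hyz
      have same : ∀ u v w, G.Adj u v → G.Adj u w → ¬ G.Adj v w := by
        intro u v w h1 h2 h3
        have e1 := hcol _ _ h1
        have e2 := hcol _ _ h2
        have e3 := hcol _ _ h3
        revert e1 e2 e3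
        cases col u <;> cases col v <;> cases col w <;> simp
      have n1 := same _ _ _ a1 a2
      have n2 := same _ _ _ a3 a4
      have n3 := same _ _ _ a5 a6
      have n4 := same _ _ _ a2.symm a4.symm
      have n5 := same _ _ _ a1.symm a6.symm
      have n6 := same _ _ _ a3.symm a5.symm
      have m1 : p ≠ q := by rintro rfl; exact hpx a3
      have m2 : p ≠ r := by rintro rfl; exact hpx a5
      have m3 : q ≠ r := by rintro rfl; exact hqy a6
      let w : ℕ → V := fun s => if s = 0 then x else if s = 1 then r else if s = 2 then y
        else if s = 3 then p else z
      have w0 : w 0 = x := rfl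
      have w1 : w 1 = r := rfl
      have w2 : w 2 = y := rfl
      have w3 : w 3 = p := rfl
      have w4 : w 4 = z := rfl
      have sy : ∀ u v, ¬ G.Adj u v → ¬ G.Adj v u := fun u v h h' => h h'.symm
      have b1 := a1.symm
      have b2 := a2.symm
      have b3 := a3.symm
      have b4 := a4.symm
      have b5 := a5.symm
      have b6 := a6.symm
      have c1 := sy _ _ n1
      have c2 := sy _ _ n2
      have c3 := sy _ _ n3
      have c4 := sy _ _ n4
      have c5 := sy _ _ n5
      have c6 := sy _ _ n6
      have c7 := sy _ _ hpx
      have c8 := sy _ _ hqy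
      have c9 := sy _ _ hrz
      have e1 := a1.ne
      have e2 := a2.ne
      have e3 := a3.ne
      have e4 := a4.ne
      have e5 := a5.ne
      have e6 := a6.ne
      have e7 : q ≠ y := by rintro rfl; exact c3 a3
      have e8 : p ≠ x := by rintro rfl; exact n3 a1
      have e9 : r ≠ z := by rintro rfl; exact c2 a5
      clear_value w
      clear hp hq hr her hcon hpair ih same sy
      refine cycle_of_path G w q 4 le_rfl ?_ ?_ ?_ ?_ hno
      · intro s t hs ht
        interval_cases s <;> interval_cases t <;>
          simp only [w0, w1, w2, w3, w4] <;>
          simp [a1, a2, a3, a4, a5, a6, b1, b2, b3, b4, b5, b6, n1, n2, n3, n4, n5, n6,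
            c1, c2, c3, c4, c5, c6, c7, c8, c9, hpx, hqy, hrz]
      · intro s t hs ht h
        interval_cases s <;> interval_cases t <;> simp only [w0, w1, w2, w3, w4] at h <;>
          first
          | rfl
          | (exfalso; simp [*] at h; done)
          | (exfalso; replace h := h.symm; simp [*] at h; done)
      · intro s hs
        interval_cases s <;> simp only [w0, w1, w2, w3, w4] <;>
          simp [a1, a2, a3, a4, a5, a6, b1, b2, b3, b4, b5, b6, n1, n2, n3, n4, n5, n6,
            c1, c2, c3, c4, c5, c6, c7, c8, c9, hpx, hqy, hrz]
      · intro s hs h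
        interval_cases s <;> simp only [w0, w1, w2, w3, w4] at h
        · exact e3 h
        · exact m3 h
        · exact e7 h
        · exact m1 h.symm
        · exact e4 h

theorem ZFree_ext {V : Type*} {G : SimpleGraph V} {k : ℕ} (hZ : ZFree (k + 1) G)
    (a b : Fin k → V) (hab : ∀ i j, G.Adj (a i) (b j) ↔ i ≤ j) (p q : V)
    (hp : ∀ i, G.Adj (a i) p) (hqp : G.Adj q p) (hq : ∀ j, ¬ G.Adj q (b j)) : False := by
  refine hZ ⟨Fin.snoc a q, Fin.snoc b p, fun i j => ?_⟩
  induction i using Fin.lastCases with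
  | last =>
    induction j using Fin.lastCases with
    | last => simp [hqp]
    | cast j =>
      simp only [Fin.snoc_last, Fin.snoc_castSucc, hq, false_iff, not_le]
      exact Fin.castSucc_lt_last j
  | cast i =>
    induction j using Fin.lastCases with
    | last => simp [hp, Fin.le_last]
    | cast j => simp [hab]

theorem block_free {V : Type*} (G : SimpleGraph V) (L : V → ℕ) (k m : ℕ)
    (h1 : ∀ u v, G.Adj u v → L u = L v + 1 ∨ L v = L u + 1) (X : V → Prop)
    (hX : ∀ u, X u → L u = m ∨ L u = m + 1)
    (hext : ∀ a b : Fin (k + 1) → V, (∀ i j, G.Adj (a i) (b j) ↔ i ≤ j) → (∀ i, X (a i)) →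
      (∀ i, X (b i)) → (∀ i, L (a i) = m) → (∀ i, L (b i) = m + 1) → False) :
    ZFree (k + 1) (G.induce {u | X u}) := by
  rintro ⟨a', b', hab'⟩
  let a : Fin (k + 1) → V := fun i => (a' i).1
  let b : Fin (k + 1) → V := fun i => (b' i).1
  have hab : ∀ i j, G.Adj (a i) (b j) ↔ i ≤ j := fun i j => hab' i j
  have ha : ∀ i, X (a i) := fun i => (a' i).2
  have hb : ∀ i, X (b i) := fun i => (b' i).2
  have h0 : ∀ j, G.Adj (a 0) (b j) := fun j => (hab 0 j).2 (Fin.zero_le j)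
  have hl : ∀ i, G.Adj (a i) (b (Fin.last k)) := fun i => (hab i _).2 (Fin.le_last i)
  rcases hX _ (ha 0) with e | e
  · have hLb : ∀ j, L (b j) = m + 1 := by
      intro j
      have := h1 _ _ (h0 j)
      have := hX _ (hb j)
      omega
    have hLa : ∀ i, L (a i) = m := by
      intro i
      have := h1 _ _ (hl i)
      have := hX _ (ha i)
      have := hLb (Fin.last k)
      omega
    exact hext a b hab ha hb hLa hLb
  · have hLb : ∀ j, L (b j) = m := by
      intro j
      have := h1 _ _ (h0 j)
      have := hX _ (hb j)
      omega
    have hLa : ∀ i, L (a i) = m + 1 := by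
      intro i
      have := h1 _ _ (hl i)
      have := hX _ (ha i)
      have := hLb (Fin.last k)
      omega
    refine hext (fun i => b i.rev) (fun i => a i.rev) ?_ (fun i => hb _) (fun i => ha _)
      (fun i => hLb _) (fun i => hLa _)
    intro i j
    rw [G.adj_comm, hab, Fin.rev_le_rev]

theorem NoLong_induce {V : Type*} {G : SimpleGraph V} (h : NoLong G) (s : Set V) :
    NoLong (G.induce s) := by
  rintro m hm ⟨e⟩
  exact h m hm ⟨(SimpleGraph.Embedding.induce s).comp e⟩

/-- The edge set is a union, indexed by `ι`, of disjoint unions of bicliques. -/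
def Decomposes (ι : Type) (k : ℕ) : Prop :=
  ∀ (V : Type) [Finite V] (G : SimpleGraph V) (col : V → Bool),
    (∀ u v, G.Adj u v → col u ≠ col v) → NoLong G → ZFree k G →
    ∃ f : ι → V → V, ∀ u v, col u ≠ col v → (G.Adj u v ↔ ∃ i, f i u = f i v)

theorem glue {ι : Type} {k : ℕ} (hι : Decomposes ι k) (V : Type) [Finite V] (G : SimpleGraph V)
    (col : V → Bool) (hcol : ∀ u v, G.Adj u v → col u ≠ col v) (hno : NoLong G) (π : V → ℕ)
    (hfree : ∀ j, j ≠ 0 → ZFree k (G.induce {u | π u = j})) :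
    ∃ f : ι → V → V, ∀ u v, col u ≠ col v →
      ((∃ i, f i u = f i v) ↔ G.Adj u v ∧ π u = π v ∧ π u ≠ 0) := by
  classical
  have hex : ∀ j, j ≠ 0 → ∃ g : ι → {u | π u = j} → {u | π u = j}, ∀ u v : {u | π u = j},
      col u.1 ≠ col v.1 → (G.Adj u.1 v.1 ↔ ∃ i, g i u = g i v) := by
    intro j hj
    exact hι _ (G.induce {u | π u = j}) (fun u => col u.1) (fun u v h => hcol _ _ h)
      (NoLong_induce hno _) (hfree j hj)
  choose g hg using hex
  let f : ι → V → V := fun i u => if h : π u = 0 then u else (g (π u) h i ⟨u, rfl⟩).1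
  have hf0 : ∀ i u, π u = 0 → f i u = u := fun i u h => by simp [f, h]
  have hf1 : ∀ i u j (hj : j ≠ 0) (hu : π u = j), f i u = (g j hj i ⟨u, hu⟩).1 := by
    intro i u j hj hu
    subst hu
    simp [f, hj]
  have hfπ : ∀ i u, π (f i u) = π u := by
    intro i u
    by_cases h : π u = 0
    · rw [hf0 i u h]
    · rw [hf1 i u _ h rfl]
      exact (g (π u) h i ⟨u, rfl⟩).2
  refine ⟨f, fun u v huv => ?_⟩
  constructor
  · rintro ⟨i, hi⟩
    have hπ : π u = π v := by rw [← hfπ i u, hi, hfπ]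
    by_cases h : π u = 0
    · rw [hf0 i u h, hf0 i v (hπ ▸ h)] at hi
      exact absurd (congrArg col hi) huv
    · refine ⟨?_, hπ, h⟩
      rw [hf1 i u _ h rfl, hf1 i v _ h hπ.symm] at hi
      exact (hg _ h ⟨u, rfl⟩ ⟨v, hπ.symm⟩ huv).2 ⟨i, Subtype.ext hi⟩
  · rintro ⟨hadj, hπ, h⟩
    obtain ⟨i, hi⟩ := (hg _ h ⟨u, rfl⟩ ⟨v, hπ.symm⟩ huv).1 hadj
    refine ⟨i, ?_⟩
    rw [hf1 i u _ h rfl, hf1 i v _ h hπ.symm, hi]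

theorem decompose_step {ι : Type} {k : ℕ} (hι : Decomposes ι (k + 1)) :
    Decomposes (Unit ⊕ ((ι ⊕ ι) ⊕ (ι ⊕ ι))) (k + 2) := by
  classical
  intro V _ G col hcol hno hZ
  haveI := Fintype.ofFinite V
  obtain ⟨root, L, h1, h2, h3, h4, h5⟩ := exists_layers G col hcol
  have hroot1 : ∀ x, L x = 1 → G.Adj x (root x) := by
    intro x hx
    obtain ⟨v, hv, hL⟩ := h2 x (by omega)
    rw [h3 _ _ hv, ← h4 v (by omega)]
    exact hv
  let D : V → Prop := fun b => L b = 2 ∧ ∀ x, L x = 1 → root x = root b → G.Adj b x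
  let P : V → Prop := fun b => L b = 2 ∧ ¬ D b
  have hq : ∀ r, ∃ q1 q2, ∀ b, P b → root b = r →
      (L q1 = 1 ∧ root q1 = r ∧ L q2 = 1 ∧ root q2 = r ∧ ¬ (G.Adj b q1 ∧ G.Adj b q2)) := by
    intro r
    by_cases hex : ∃ b, P b ∧ root b = r
    swap
    · exact ⟨r, r, fun b hb hr => absurd ⟨b, hb, hr⟩ hex⟩
    by_contra hcon
    push Not at hcon
    let S : Finset V := Finset.univ.filter (fun x => L x = 1 ∧ root x = r)
    have hS : ∀ x, x ∈ S ↔ L x = 1 ∧ root x = r := by intro x; simp [S]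
    have hne : S.Nonempty := by
      obtain ⟨b, hb, hr⟩ := hex
      have hb2 := hb.1
      obtain ⟨v, hv, hL⟩ := h2 b (by omega)
      exact ⟨v, (hS v).2 ⟨by omega, (h3 _ _ hv).symm.trans hr⟩⟩
    obtain ⟨p, hp, hpS⟩ := helly G hno col hcol P _ S rfl hne (by
      intro x hx y hy
      rw [hS] at hx hy
      obtain ⟨b, hb, hr, hh⟩ := hcon x y
      exact ⟨b, hb, hh hx.1 hx.2 hy.1 hy.2⟩)
    obtain ⟨v, hv⟩ := hne
    have hrp : root p = r := (h3 _ _ (hpS v hv)).trans ((hS v).1 hv).2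
    exact hp.2 ⟨hp.1, fun x hx hxr => hpS x ((hS x).2 ⟨hx, hxr.trans hrp⟩)⟩
  choose q1 q2 hq using hq
  -- freeness of the four families of blocks
  have hlow : ∀ (q : V → V), (∀ b, P b → L (q (root b)) = 1 ∧ root (q (root b)) = root b) →
      ZFree (k + 1) (G.induce {u | L u = 1 ∨ (P u ∧ ¬ G.Adj u (q (root u)))}) := by
    intro q hqq
    refine block_free G L k 1 h1 _ ?_ ?_
    · rintro u (h | h)
      · exact Or.inl h
      · exact Or.inr h.1.1
    · intro a b hab ha hb hLa hLb
      have hb' : ∀ j, P (b j) ∧ ¬ G.Adj (b j) (q (root (b j))) := by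
        intro j
        rcases hb j with h | h
        · have := hLb j; omega
        · exact h
      have hra : ∀ i, root (a i) = root (b (Fin.last k)) := fun i =>
        h3 _ _ ((hab i _).2 (Fin.le_last i))
      have hrb : ∀ j, root (b j) = root (b (Fin.last k)) := fun j =>
        (h3 _ _ ((hab 0 j).2 (Fin.zero_le j))).symm.trans (hra 0)
      have hql := hqq _ (hb' (Fin.last k)).1
      refine ZFree_ext hZ a b hab (root (b (Fin.last k))) (q (root (b (Fin.last k)))) ?_ ?_ ?_
      · intro i
        rw [← hra i]
        exact hroot1 _ (hLa i)
      · have := hroot1 _ hql.1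
        rwa [hql.2] at this
      · intro j h
        have := (hb' j).2
        rw [hrb j] at this
        exact this h.symm
  have hhigh : ∀ (m : ℕ), 2 ≤ m → ∀ X : V → Prop, (∀ u, X u → L u = m ∨ L u = m + 1) →
      ZFree (k + 1) (G.induce {u | X u}) := by
    intro m hm X hX
    refine block_free G L k m h1 _ hX ?_
    intro a b hab ha hb hLa hLb
    have hl : ∀ i, G.Adj (a i) (b (Fin.last k)) := fun i => (hab i _).2 (Fin.le_last i)
    obtain ⟨p, hp, hpS⟩ := helly G hno col hcol (fun p => L p + 1 = m) _
      (Finset.univ.image a) rfl (by simp) (by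
        intro x hx y hy
        simp only [Finset.mem_image, Finset.mem_univ, true_and] at hx hy
        obtain ⟨i, rfl⟩ := hx
        obtain ⟨j, rfl⟩ := hy
        obtain ⟨p, hp, hp1, hp2⟩ := common_down G hno root L h1 h2 h3 h4 col hcol m (by omega)
          (a i) (a j) _ (hLa i) (hLa j) (hLb _) (hl i) (hl j)
        exact ⟨p, hp, hp1.symm, hp2.symm⟩)
    obtain ⟨q, hqp, hqL⟩ := h2 p (by omega)
    refine ZFree_ext hZ a b hab p q (fun i => (hpS _ (by simp)).symm) hqp.symm ?_
    intro j h
    have e1 := h1 _ _ h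
    have e2 := hLb j
    omega
  -- the four families
  obtain ⟨f0, hf0⟩ := glue hι V G col hcol hno
    (fun u => if L u = 1 ∨ (P u ∧ ¬ G.Adj u (q1 (root u))) then 1 else 0) (by
      intro j hj
      by_cases hj1 : j = 1
      · subst hj1
        have := hlow q1 (fun b hb => ⟨(hq _ b hb rfl).1, (hq _ b hb rfl).2.1⟩)
        have hset : ∀ S T : Set V, S = T → ZFree (k + 1) (G.induce T) →
            ZFree (k + 1) (G.induce S) := by
          rintro S T rfl h; exact h
        refine hset _ _ ?_ this
        ext u
        simp only [Set.mem_setOf_eq]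
        split_ifs with h
        · exact ⟨fun _ => h, fun _ => rfl⟩
        · exact ⟨fun h' => absurd h' (by decide), fun h' => absurd h' h⟩
      · rintro ⟨a, -⟩
        have := (a 0).2
        simp only [Set.mem_setOf_eq] at this
        split_ifs at this <;> omega)
  obtain ⟨f1, hf1⟩ := glue hι V G col hcol hno
    (fun u => if L u = 1 ∨ (P u ∧ ¬ G.Adj u (q2 (root u))) then 1 else 0) (by
      intro j hj
      by_cases hj1 : j = 1
      · subst hj1
        have := hlow q2 (fun b hb => ⟨(hq _ b hb rfl).2.2.1, (hq _ b hb rfl).2.2.2.1⟩)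
        have hset : ∀ S T : Set V, S = T → ZFree (k + 1) (G.induce T) →
            ZFree (k + 1) (G.induce S) := by
          rintro S T rfl h; exact h
        refine hset _ _ ?_ this
        ext u
        simp only [Set.mem_setOf_eq]
        split_ifs with h
        · exact ⟨fun _ => h, fun _ => rfl⟩
        · exact ⟨fun h' => absurd h' (by decide), fun h' => absurd h' h⟩
      · rintro ⟨a, -⟩
        have := (a 0).2
        simp only [Set.mem_setOf_eq] at this
        split_ifs at this <;> omega)
  obtain ⟨f2, hf2⟩ := glue hι V G col hcol hno (fun u => L u / 2)
    (fun j hj => hhigh (2 * j) (by omega) _ (fun u hu => by omega))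
  obtain ⟨f3, hf3⟩ := glue hι V G col hcol hno (fun u => (L u - 1) / 2)
    (fun j hj => hhigh (2 * j + 1) (by omega) _ (fun u hu => by omega))
  let E : V → Prop := fun u => L u = 0 ∨ D u
  have hE : ∀ u, E u → ∀ x, L x = 1 → root x = root u → G.Adj u x := by
    rintro u (hu | hu) x hx hr
    · rw [h4 u hu, ← hr]
      exact (hroot1 x hx).symm
    · exact hu.2 x hx hr
  have hEcol : ∀ u, E u → col u = col (root u) := by
    rintro u (hu | hu)
    · rw [← h4 u hu]
    · have hu2 := hu.1
      obtain ⟨x, hx, hxL⟩ := h2 u (by omega)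
      have c1 := hcol _ _ hx
      have c2 := hcol _ _ (hroot1 x (by omega))
      rw [← h3 _ _ hx] at c2
      revert c1 c2
      cases col u <;> cases col (root u) <;> cases col x <;> simp
  let s : V → V := fun u => if L u = 1 ∨ E u then root u else u
  refine ⟨Sum.elim (fun _ => s)
    (Sum.elim (Sum.elim f0 f1) (Sum.elim f2 f3)), fun u v huv => ?_⟩
  have hiff : ∀ u v, (∃ i, Sum.elim (fun _ : Unit => s)
      (Sum.elim (Sum.elim f0 f1) (Sum.elim f2 f3)) i u = Sum.elim (fun _ : Unit => s)
      (Sum.elim (Sum.elim f0 f1) (Sum.elim f2 f3)) i v) ↔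
      s u = s v ∨ ((∃ i, f0 i u = f0 i v) ∨ (∃ i, f1 i u = f1 i v)) ∨
        ((∃ i, f2 i u = f2 i v) ∨ (∃ i, f3 i u = f3 i v)) := by
    intro u v
    simp [Sum.exists]
  rw [hiff]
  have hmain : ∀ u v, G.Adj u v → L v = L u + 1 →
      (s u = s v ∨ ((∃ i, f0 i u = f0 i v) ∨ (∃ i, f1 i u = f1 i v)) ∨
        ((∃ i, f2 i u = f2 i v) ∨ (∃ i, f3 i u = f3 i v))) := by
    intro u v h hL
    have hc := hcol _ _ h
    have hr := h3 _ _ h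
    rw [hf0 u v hc, hf1 u v hc, hf2 u v hc, hf3 u v hc]
    by_cases e0 : L u = 0
    · left
      simp [s, E, e0, hL, hr]
    by_cases e1 : L u = 1
    · by_cases hD : D v
      · left
        simp [s, E, e1, hD, hr]
      · have hP : P v := ⟨by omega, hD⟩
        have hh := (hq _ v hP rfl).2.2.2.2
        right; left
        by_cases ha : G.Adj v (q1 (root v))
        · right
          have hb : ¬ G.Adj v (q2 (root v)) := fun hb => hh ⟨ha, hb⟩
          simp [h, e1, hP, hb]
        · left
          simp [h, e1, hP, ha]
    · right; right
      rcases Nat.even_or_odd (L u) with ⟨r, hr⟩ | ⟨r, hr⟩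
      · left
        exact ⟨h, by omega, by omega⟩
      · right
        exact ⟨h, by omega, by omega⟩
  constructor
  · intro h
    rcases h1 _ _ h with e | e
    · rw [← hiff]
      obtain ⟨i, hi⟩ := (hiff v u).2 (hmain v u h.symm e)
      exact ⟨i, hi.symm⟩
    · exact hmain u v h e
  · rintro (h | (h | h) | (h | h))
    · -- dominating bicliques
      by_cases hu : L u = 1 ∨ E u <;> by_cases hv : L v = 1 ∨ E v <;>
        simp only [s, hu, hv, if_true, if_false] at h
      · rcases hu with hu | hu <;> rcases hv with hv | hv
        · exfalso
          have c1 := hcol _ _ (hroot1 u hu)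
          have c2 := hcol _ _ (hroot1 v hv)
          rw [h] at c1
          revert c1 c2 huv
          cases col u <;> cases col v <;> cases col (root v) <;> simp
        · exact (hE v hv u hu h).symm
        · exact hE u hu v hv h.symm
        · exact absurd ((hEcol u hu).trans ((congrArg col h).trans (hEcol v hv).symm)) huv
      · exact absurd (Or.inr (Or.inl (h ▸ h5 u))) hv
      · exact absurd (Or.inr (Or.inl (h ▸ h5 v))) hu
      · exact absurd (congrArg col h) huv
    · exact ((hf0 u v huv).1 h).1
    · exact ((hf1 u v huv).1 h).1
    · exact ((hf2 u v huv).1 h).1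
    · exact ((hf3 u v huv).1 h).1

theorem exists_decompose (k : ℕ) : ∃ (ι : Type) (_ : Fintype ι), Decomposes ι (k + 1) := by
  induction k with
  | zero =>
    refine ⟨Empty, inferInstance, ?_⟩
    intro V _ G col hcol hno hZ
    refine ⟨fun e => e.elim, fun u v huv => ?_⟩
    constructor
    · intro h
      exact absurd ⟨fun _ => u, fun _ => v, fun i j => ⟨fun _ => by omega, fun _ => h⟩⟩ hZ
    · rintro ⟨e, -⟩
      exact e.elim
  | succ k ih =>
    obtain ⟨ι, hfin, h⟩ := ih
    exact ⟨_, inferInstance, decompose_step h⟩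

/-- Injective codes for tuples of naturals, with polynomial bounds. -/
theorem exists_code (m : ℕ) : ∃ (c : ℕ) (e : (Fin m → ℕ) → ℕ), Function.Injective e ∧
    ∀ n, 2 ≤ n → ∀ s : Fin m → ℕ, (∀ i, s i < n) → e s < n ^ c := by
  induction m with
  | zero =>
    refine ⟨0, fun _ => 0, fun s t _ => Subsingleton.elim s t, fun n hn s _ => by simp⟩
  | succ m ih =>
    obtain ⟨c, e, he, hb⟩ := ih
    refine ⟨(c + 1) * 2, fun s => Nat.pair (s 0) (e (Fin.tail s)), ?_, ?_⟩
    · intro s t h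
      rw [Nat.pair_eq_pair] at h
      have := he h.2
      rw [← Fin.cons_self_tail s, ← Fin.cons_self_tail t, this, h.1]
    · intro n hn s hs
      have h1 : s 0 < n ^ (c + 1) := lt_of_lt_of_le (hs 0) (Nat.le_self_pow (by omega) n)
      have h2 : e (Fin.tail s) < n ^ (c + 1) :=
        lt_of_lt_of_le (hb n hn _ (fun i => hs _)) (Nat.pow_le_pow_right (by omega) (by omega))
      rw [pow_mul]
      refine lt_of_lt_of_le (Nat.pair_lt_max_add_one_sq _ _) (Nat.pow_le_pow_left ?_ 2)
      omega

theorem implicit_of_ZFree (k : ℕ) (C : GraphClass)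
    (hC : ∀ n G, C n G → ChordalBipartite G ∧ ZFree (k + 1) G) : AdmitsImplicit C := by
  classical
  obtain ⟨ι, hfin, hι⟩ := exists_decompose k
  let N := Fintype.card ι
  let eq : ι ≃ Fin N := Fintype.equivFin ι
  obtain ⟨c, e, he, hb⟩ := exists_code (N + 2)
  refine ⟨c, fun x y => ∃ s t : Fin (N + 2) → ℕ, x = e s ∧ y = e t ∧ s 0 ≠ t 0 ∧
    ∃ i : Fin N, s i.succ.succ = t i.succ.succ, ?_⟩
  intro n hn G hG
  obtain ⟨⟨hcolb, hno⟩, hZ⟩ := hC n G hG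
  obtain ⟨c2⟩ := hcolb
  let col : Fin n → Bool := fun v => decide (c2 v = 0)
  have hcol : ∀ u v, G.Adj u v → col u ≠ col v := by
    intro u v h
    have := c2.valid h
    simp only [col]
    revert this
    generalize c2 u = a
    generalize c2 v = b
    revert a b
    decide
  obtain ⟨f, hf⟩ := hι (Fin n) G col hcol hno hZ
  let s : Fin n → Fin (N + 2) → ℕ := fun u =>
    Fin.cons (if col u then 1 else 0) (Fin.cons u.val (fun i => (f (eq.symm i) u).val))
  have s0 : ∀ u, s u 0 = if col u then 1 else 0 := fun u => rfl
  have s1 : ∀ u, s u 1 = u.val := fun u => rfl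
  have s2 : ∀ u (i : Fin N), s u i.succ.succ = (f (eq.symm i) u).val := fun u i => rfl
  have hs : ∀ u i, s u i < n := by
    intro u i
    refine Fin.cases ?_ (fun i => ?_) i
    · rw [s0]; split_ifs <;> omega
    · refine Fin.cases ?_ (fun i => ?_) i
      · exact u.isLt
      · rw [s2]; exact (f (eq.symm i) u).isLt
  refine ⟨fun u => ⟨e (s u), hb n hn _ (hs u)⟩, ?_, ?_⟩
  · intro u v h
    have h' := he (Fin.mk.inj_iff.1 h)
    apply Fin.ext
    rw [← s1 u, ← s1 v, h']
  · intro u v huv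
    dsimp only
    have hc : s u 0 ≠ s v 0 ↔ col u ≠ col v := by
      rw [s0, s0]
      cases col u <;> cases col v <;> simp
    constructor
    · intro h
      refine ⟨s u, s v, rfl, rfl, hc.2 (hcol u v h), ?_⟩
      obtain ⟨i, hi⟩ := (hf u v (hcol u v h)).1 h
      refine ⟨eq i, ?_⟩
      rw [s2, s2]
      simp [hi]
    · rintro ⟨s', t', h1, h2, h3, i, hi⟩
      rw [← he h1, ← he h2] at h3 hi
      refine (hf u v (hc.1 h3)).2 ⟨eq.symm i, ?_⟩
      rw [s2, s2] at hi
      exact Fin.ext hi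

/-- Every chain graph embeds in a half graph. -/
theorem chain_in_half {W : Type*} [Fintype W] (H : SimpleGraph W) (c : H.Coloring (Fin 2))
    (hHchain : ¬ Nonempty (twoK2 ↪g H)) :
    ∃ (k : ℕ) (i j : W → Fin (k + 1)), Function.Injective i ∧ Function.Injective j ∧
      ∀ x y, c x = 0 → c y = 1 → (H.Adj x y ↔ i x ≤ j y) := by
  classical
  have hchain : ∀ x x' y y', c x = 0 → c x' = 0 → c y = 1 → c y' = 1 → H.Adj x y →
      H.Adj x' y' → H.Adj x y' ∨ H.Adj x' y := by
    intro x x' y y' hx hx' hy hy' h h'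
    by_contra hcon
    push Not at hcon
    obtain ⟨n1, n2⟩ := hcon
    apply hHchain
    have nx : ¬ H.Adj x x' := fun h => c.valid h (hx.trans hx'.symm)
    have ny : ¬ H.Adj y y' := fun h => c.valid h (hy.trans hy'.symm)
    have e1 : x ≠ x' := by rintro rfl; exact n1 h'
    have e2 : y ≠ y' := by rintro rfl; exact n1 h
    have e3 : ∀ u v, c u = 0 → c v = 1 → u ≠ v := by
      rintro u v hu hv rfl
      rw [hu] at hv
      exact absurd hv (by decide)
    have e4 := e3 x y hx hy
    have e5 := e3 x y' hx hy'
    have e6 := e3 x' y hx' hy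
    have e7 := e3 x' y' hx' hy'
    have nx' : ¬ H.Adj x' x := fun h => nx h.symm
    have ny' : ¬ H.Adj y' y := fun h => ny h.symm
    have n1' : ¬ H.Adj y' x := fun h => n1 h.symm
    have n2' : ¬ H.Adj y x' := fun h => n2 h.symm
    refine ⟨⟨⟨![x, y, x', y'], ?_⟩, ?_⟩⟩
    · intro a b hab
      fin_cases a <;> fin_cases b <;> first
        | rfl
        | (exfalso; simp at hab; first
            | exact e1 hab | exact e2 hab | exact e4 hab | exact e5 hab | exact e6 hab
            | exact e7 hab | exact e1 hab.symm | exact e2 hab.symm | exact e4 hab.symm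
            | exact e5 hab.symm | exact e6 hab.symm | exact e7 hab.symm)
    · intro a b
      change H.Adj (![x, y, x', y'] a) (![x, y, x', y'] b) ↔ _
      fin_cases a <;> fin_cases b <;>
        simp [twoK2, h, h', h.symm, h'.symm, n1, n2, nx, ny, n1', n2', nx', ny']
  let m := Fintype.card W
  let s : W → ℕ := fun w => (Fintype.equivFin W w).val
  have hs : ∀ w, s w < m := fun w => (Fintype.equivFin W w).isLt
  have hsinj : ∀ u v, s u = s v → u = v := fun u v h =>
    (Fintype.equivFin W).injective (Fin.ext h)
  let ν : W → ℕ := fun x => (Finset.univ.filter (fun y => c y = 1 ∧ ¬ H.Adj x y)).card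
  have hν : ∀ x, ν x ≤ m := fun x => Finset.card_le_univ _
  let i0 : W → ℕ := fun x => ν x * m + s x + 1
  let J : W → ℕ := fun y => (Finset.univ.filter (fun x => H.Adj x y)).sup i0
  have hi0 : ∀ x, i0 x ≤ m * m + m := by
    intro x
    have h1 := hs x
    have h2 : ν x * m ≤ m * m := Nat.mul_le_mul_right m (hν x)
    simp only [i0]
    omega
  have hJ : ∀ y, J y ≤ m * m + m := fun y => Finset.sup_le (fun x _ => hi0 x)
  have key : ∀ x y, c x = 0 → c y = 1 → (H.Adj x y ↔ i0 x ≤ J y) := by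
    intro x y hx hy
    constructor
    · intro h
      exact Finset.le_sup (f := i0) (by simp [h])
    · intro h
      have hne : (Finset.univ.filter (fun x => H.Adj x y)).Nonempty := by
        by_contra hne
        rw [Finset.not_nonempty_iff_eq_empty] at hne
        simp only [J, hne, Finset.sup_empty, i0] at h
        simp at h
      obtain ⟨x', hx', hmax⟩ := Finset.exists_mem_eq_sup _ hne i0
      simp only [Finset.mem_filter, Finset.mem_univ, true_and] at hx'
      by_contra hnadj
      have hcx' : c x' = 0 := by
        have := c.valid hx'
        rw [hy] at this
        revert this
        generalize c x' = a
        revert a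
        decide
      have hlt : ν x' < ν x := by
        apply Finset.card_lt_card
        rw [Finset.ssubset_iff_of_subset]
        · exact ⟨y, by simp [hy, hnadj], by simp [hx']⟩
        · intro z hz
          simp only [Finset.mem_filter, Finset.mem_univ, true_and] at hz ⊢
          refine ⟨hz.1, fun hxz => ?_⟩
          rcases hchain x x' z y hx hcx' hz.1 hy hxz hx' with h' | h'
          · exact hnadj h'
          · exact hz.2 h'
      change i0 x ≤ J y at h
      have hmax' : J y = i0 x' := hmax
      rw [hmax'] at h
      have h1 := hs x'
      have h2 : (ν x' + 1) * m ≤ ν x * m := Nat.mul_le_mul_right m hlt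
      simp only [i0] at h
      rw [Nat.add_mul] at h2
      omega
  let k := m * (m * m + m) + m
  have hib : ∀ x, m * i0 x < k + 1 := by
    intro x
    have : m * i0 x ≤ m * (m * m + m) := Nat.mul_le_mul_left m (hi0 x)
    simp only [k]; omega
  have hjb : ∀ y, m * J y + s y < k + 1 := by
    intro y
    have : m * J y ≤ m * (m * m + m) := Nat.mul_le_mul_left m (hJ y)
    have := hs y
    simp only [k]; omega
  refine ⟨k, fun x => ⟨m * i0 x, hib x⟩, fun y => ⟨m * J y + s y, hjb y⟩, ?_, ?_, ?_⟩
  · intro x x' h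
    have h' : m * i0 x = m * i0 x' := Fin.mk.inj_iff.1 h
    have hm : 0 < m := lt_of_le_of_lt (Nat.zero_le _) (hs x)
    have h2 := Nat.eq_of_mul_eq_mul_left hm h'
    apply hsinj
    have h3 : (ν x * m + s x) % m = (ν x' * m + s x') % m := by
      congr 1
      simp only [i0] at h2
      omega
    rwa [Nat.mul_add_mod_self_right, Nat.mul_add_mod_self_right, Nat.mod_eq_of_lt (hs x),
      Nat.mod_eq_of_lt (hs x')] at h3
  · intro y y' h
    have h' : m * J y + s y = m * J y' + s y' := Fin.mk.inj_iff.1 h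
    apply hsinj
    have h3 := congrArg (· % m) h'
    simpa only [Nat.mul_add_mod_self_left, Nat.mod_eq_of_lt (hs _)] using h3
  · intro x y hx hy
    rw [key x y hx hy, Fin.mk_le_mk]
    have h1 := hs y
    constructor
    · intro h
      have := Nat.mul_le_mul_left m h
      omega
    · intro h
      by_contra hcon
      have : m * (J y + 1) ≤ m * i0 x := Nat.mul_le_mul_left m (by omega)
      rw [Nat.mul_add] at this
      omega

/-- For every finite chain graph `H` (a bipartite `2K₂`-free graph), the class of
`H`-free chordal bipartite graphs admits an implicit representation. -/
theorem statement13 {W : Type*} [Fintype W] (H : SimpleGraph W)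
    (hHbip : H.Colorable 2) (hHchain : ¬ Nonempty (twoK2 ↪g H)) :
    AdmitsImplicit (fun n G => ChordalBipartite G ∧ ¬ Nonempty (H ↪g G)) := by
  classical
  obtain ⟨c⟩ := hHbip
  obtain ⟨k, i, j, hi, hj, hij⟩ := chain_in_half H c hHchain
  refine implicit_of_ZFree k _ ?_
  rintro n G ⟨hG, hfree⟩
  refine ⟨hG, ?_⟩
  rintro ⟨a, b, hab⟩
  apply hfree
  obtain ⟨⟨g⟩, -⟩ := hG
  have h2 : ∀ p q r : Fin 2, p ≠ q → r ≠ q → p = r := by decide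
  have hl : ∀ i, g (a i) ≠ g (b (Fin.last k)) := fun i => g.valid ((hab i _).2 (Fin.le_last i))
  have h0 : ∀ j, g (b j) ≠ g (a 0) := fun j => g.valid ((hab 0 j).2 (Fin.zero_le j)).symm
  have hga : ∀ i i', g (a i) = g (a i') := fun i i' => h2 _ _ _ (hl i) (hl i')
  have hgb : ∀ i i', g (b i) = g (b i') := fun i i' => h2 _ _ _ (h0 i) (h0 i')
  have hgab : ∀ i i', g (a i) ≠ g (b i') := by
    intro i i' h
    rw [hga i 0] at h
    exact h0 i' h.symm
  have hna : ∀ i i', ¬ G.Adj (a i) (a i') := fun i i' h => g.valid h (hga i i')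
  have hnb : ∀ i i', ¬ G.Adj (b i) (b i') := fun i i' h => g.valid h (hgb i i')
  have hainj : ∀ i i', a i = a i' → i = i' := by
    intro i i' h
    apply le_antisymm
    · rw [← hab, h, hab]
    · rw [← hab, ← h, hab]
  have hbinj : ∀ i i', b i = b i' → i = i' := by
    intro i i' h
    apply le_antisymm
    · rw [← hab, ← h, hab]
    · rw [← hab, h, hab]
  have hc1 : ∀ w, c w ≠ 0 → c w = 1 := by
    intro w
    generalize c w = x
    revert x
    decide
  refine ⟨⟨⟨fun w => if c w = 0 then a (i w) else b (j w), ?_⟩, ?_⟩⟩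
  · intro u v huv
    dsimp only at huv
    split_ifs at huv with h1 h2 h2
    · exact hi (hainj _ _ huv)
    · exact absurd (congrArg g huv) (hgab _ _)
    · exact absurd (congrArg g huv).symm (hgab _ _)
    · exact hj (hbinj _ _ huv)
  · intro u v
    change G.Adj (if c u = 0 then a (i u) else b (j u)) (if c v = 0 then a (i v) else b (j v)) ↔ _
    split_ifs with h1 h2 h2
    · exact ⟨fun h => absurd h (hna _ _), fun h => absurd (h1.trans h2.symm) (c.valid h)⟩
    · rw [hab, hij u v h1 (hc1 v h2)]
    · rw [G.adj_comm, hab, H.adj_comm, hij v u h2 (hc1 u h1)]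
    · exact ⟨fun h => absurd h (hnb _ _),
        fun h => absurd ((hc1 u h1).trans (hc1 v h2).symm) (c.valid h)⟩
end
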